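/- Let (X,d) be a compact metric space, φ a continuous flow on X without fixed points, μ a φ-invariant Borel probability measure, τ>0, p>0, and L∈ℕ with L ≥ (2·log 6 + p)/(pτ). Let μ = ∫_Y μ_y dπ(y) be the ergodic decomposition of μ with respect to the homeomorphism φ_{Lτ}, with h(y)=h_{μ_y}(φ_{Lτ}) the entropy of the ergodic component μ_y, and for M>0 let X_M be the union of those ergodic components with h(y)<M. Then for every ε>0 sufficiently small, ∫_{X_M} [ p + liminf_{n→∞} −(1/(nLτ)) log μ(B(x,nLτ,ε,φ)) ] dμ(x) ≥ (1/(Lτ)) ∫_{h^{−1}([0,M))} h(y) dπ(y). -/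

import Mathlib

open MeasureTheory Filter Set Topology
open scoped ENNReal NNReal

namespace FlowEntropy

variable {X : Type*}

/-- A continuous flow on `X`. -/
structure IsFlow [TopologicalSpace X] (φ : ℝ → X → X) : Prop where
  cont : Continuous fun p : ℝ × X => φ p.1 p.2
  map_zero : ∀ x, φ 0 x = x
  map_add : ∀ s t : ℝ, ∀ x, φ (s + t) x = φ s (φ t x)

/-- The flow has no fixed points. -/
def FixedPointFree (φ : ℝ → X → X) : Prop :=
  ∀ x : X, ∃ t : ℝ, φ t x ≠ x

/-- The measure `μ` is invariant under every time-`t` map of the flow. -/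
def FlowInvariant [MeasurableSpace X] (φ : ℝ → X → X) (μ : Measure X) : Prop :=
  ∀ t : ℝ, MeasurePreserving (φ t) μ μ

/-- The measure `μ` is invariant and ergodic for the flow: every Borel set invariant
under all time-`t` maps has measure `0` or `1`. -/
def FlowErgodic [MeasurableSpace X] (φ : ℝ → X → X) (μ : Measure X) : Prop :=
  FlowInvariant φ μ ∧
    ∀ B : Set X, MeasurableSet B → (∀ t : ℝ, φ t ⁻¹' B = B) → μ B = 0 ∨ μ B = 1

/-- `α` is a reparametrization on the closed interval `I` (containing the origin):
a continuous map that is a homeomorphism onto its image (equivalently, continuous and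
injective on the compact interval), fixing the origin. -/
def IsReparOn (α : ℝ → ℝ) (I : Set ℝ) : Prop :=
  ContinuousOn α I ∧ Set.InjOn α I ∧ α 0 = 0

/-- The reparametrization ball `B(x, t, ε, φ)`. -/
def reparBall [PseudoMetricSpace X] (φ : ℝ → X → X) (x : X) (t ε : ℝ) : Set X :=
  {y : X | ∃ α : ℝ → ℝ, IsReparOn α (Set.Icc 0 t) ∧
      ∀ s ∈ Set.Icc (0 : ℝ) t, dist (φ (α s) x) (φ s y) < ε}

/-- `M^s_{N,ε}(φ, Z)`: infimum of `Σ_i exp (-s t_i)` over countable families of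
reparametrization balls `B(x_i, t_i, ε, φ)` with `t_i ≥ N` covering `Z`. -/
noncomputable def coverM [PseudoMetricSpace X] (φ : ℝ → X → X) (Z : Set X) (s : ℝ) (N : ℕ)
    (ε : ℝ) : ℝ≥0∞ :=
  ⨅ (F : Set (X × ℝ)) (_ : F.Countable) (_ : ∀ p ∈ F, (N : ℝ) ≤ p.2)
    (_ : Z ⊆ ⋃ p ∈ F, reparBall φ p.1 p.2 ε),
    ∑' p : F, ENNReal.ofReal (Real.exp (-s * (p : X × ℝ).2))

/-- `M^s_ε(φ, Z) = lim_{N → ∞} M^s_{N,ε}(φ, Z)` (an increasing limit). -/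
noncomputable def coverMeps [PseudoMetricSpace X] (φ : ℝ → X → X) (Z : Set X) (s ε : ℝ) :
    ℝ≥0∞ :=
  ⨆ N : ℕ, coverM φ Z s N ε

/-- `M^s(φ, Z) = lim_{ε → 0} M^s_ε(φ, Z)` (an increasing limit as `ε` decreases). -/
noncomputable def coverMlim [PseudoMetricSpace X] (φ : ℝ → X → X) (Z : Set X) (s : ℝ) :
    ℝ≥0∞ :=
  ⨆ (ε : ℝ) (_ : 0 < ε), coverMeps φ Z s ε

/-- The Bowen entropy `h_top^B(φ, Z)`: the critical value where `M^s(φ,Z)` jumps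
from `∞` to `0` (as an extended nonnegative real; `⊤` if no finite critical value). -/
noncomputable def bowenEntropy [PseudoMetricSpace X] (φ : ℝ → X → X) (Z : Set X) : ℝ≥0∞ :=
  ⨅ (s : ℝ) (_ : 0 ≤ s) (_ : coverMlim φ Z s = 0), ENNReal.ofReal s

/-- Static entropy of a finite measurable partition, encoded as a map into a finite type. -/
noncomputable def partEnt [MeasurableSpace X] (μ : Measure X) {ι : Type*} [Fintype ι]
    (P : X → ι) : ℝ :=
  ∑ i : ι, Real.negMulLog ((μ (P ⁻¹' {i})).toReal)

/-- The measure-theoretic (Kolmogorov–Sinai) entropy of a map `T` with respect to `μ`: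
the supremum over finite measurable partitions of the asymptotic entropy per unit time of
the dynamical refinements. -/
noncomputable def kolSinai [MeasurableSpace X] (μ : Measure X) (T : X → X) : ℝ≥0∞ :=
  ⨆ (k : ℕ) (P : X → Fin k) (_ : Measurable P),
    Filter.limsup (fun n : ℕ =>
      ENNReal.ofReal (partEnt μ (fun x => fun j : Fin n => P (T^[(j : ℕ)] x)) / n))
      Filter.atTop

/-- `-log a` as a member of `ℝ≥0∞`, for `a ∈ [0,1]` (with `-log 0 = ∞`). -/
noncomputable def negLogNN (a : ℝ≥0∞) : ℝ≥0∞ :=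
  if a = 0 then ⊤ else ENNReal.ofReal (-Real.log a.toReal)

/-- `-(1/t) log μ(B(x,t,ε,φ))`, as a member of `ℝ≥0∞`. -/
noncomputable def localRate [PseudoMetricSpace X] [MeasurableSpace X] (μ : Measure X)
    (φ : ℝ → X → X) (x : X) (ε t : ℝ) : ℝ≥0∞ :=
  negLogNN (μ (reparBall φ x t ε)) / ENNReal.ofReal t

/-- The lower local entropy `underline h_μ(φ, x) = lim_{ε→0} liminf_{t→∞}
  -(1/t) log μ(B(x,t,ε,φ))` (the limit in `ε` is an increasing limit, hence a supremum). -/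
noncomputable def lowerLocalEnt [PseudoMetricSpace X] [MeasurableSpace X] (μ : Measure X)
    (φ : ℝ → X → X) (x : X) : ℝ≥0∞ :=
  ⨆ (ε : ℝ) (_ : 0 < ε), Filter.liminf (fun t : ℝ => localRate μ φ x ε t) Filter.atTop

/-- The upper local entropy `overline h_μ(φ, x) = lim_{ε→0} limsup_{t→∞}
  -(1/t) log μ(B(x,t,ε,φ))`. -/
noncomputable def upperLocalEnt [PseudoMetricSpace X] [MeasurableSpace X] (μ : Measure X)
    (φ : ℝ → X → X) (x : X) : ℝ≥0∞ :=
  ⨆ (ε : ℝ) (_ : 0 < ε), Filter.limsup (fun t : ℝ => localRate μ φ x ε t) Filter.atTop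

/-- The set `G_μ(φ)` of generic points of `μ` for the flow `φ`. -/
def genericPts [TopologicalSpace X] [MeasurableSpace X] (φ : ℝ → X → X) (μ : Measure X) :
    Set X :=
  {x : X | ∀ f : C(X, ℝ),
    Filter.Tendsto (fun t : ℝ => (1 / t) * ∫ τ in (0 : ℝ)..t, f (φ τ x))
      Filter.atTop (nhds (∫ y, f y ∂μ))}

section Entropy

variable [MeasurableSpace X]

/-- The itinerary of length `n` of a point with respect to a labelling `P`. -/
def itinerary {A : Type*} (T : X → X) (P : X → A) (n : ℕ) (x : X) : Fin n → A :=
  fun j => P (T^[(j : ℕ)] x)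

lemma measurable_itinerary {A : Type*} [MeasurableSpace A] {T : X → X} (hT : Measurable T)
    {P : X → A} (hP : Measurable P) (n : ℕ) : Measurable (itinerary T P n) :=
  measurable_pi_lambda _ fun j => hP.comp (hT.iterate j)

/-- The asymptotic entropy per unit time of a labelling. -/
noncomputable def labelEntropy {A : Type*} [Fintype A] (ν : Measure X) (T : X → X) (P : X → A) :
    ℝ≥0∞ :=
  Filter.limsup (fun n : ℕ => ENNReal.ofReal (partEnt ν (itinerary T P n) / n)) Filter.atTop

lemma kolSinai_eq (ν : Measure X) (T : X → X) :
    kolSinai ν T = ⨆ (k : ℕ) (P : X → Fin k) (_ : Measurable P), labelEntropy ν T P := rfl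

lemma integrable_comp_finite {ι : Type*} [Finite ι] [MeasurableSpace ι]
    [MeasurableSingletonClass ι] (ν : Measure X) [IsFiniteMeasure ν] {f : X → ι}
    (hf : Measurable f) (g : ι → ℝ) : Integrable (fun x => g (f x)) ν :=
  (Integrable.of_finite (f := g) (μ := ν.map f)).comp_measurable hf

lemma integral_comp_finite {ι : Type*} [Fintype ι] [MeasurableSpace ι]
    [MeasurableSingletonClass ι] (ν : Measure X) [IsFiniteMeasure ν] {f : X → ι}
    (hf : Measurable f) (g : ι → ℝ) :
    ∫ x, g (f x) ∂ν = ∑ i, ν.real (f ⁻¹' {i}) * g i := by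
  rw [← integral_map (φ := f) (f := g) hf.aemeasurable
    (Measurable.of_discrete).aestronglyMeasurable, integral_fintype Integrable.of_finite]
  refine Finset.sum_congr rfl fun i _ => ?_
  rw [smul_eq_mul, measureReal_def, Measure.map_apply hf (measurableSet_singleton i),
    measureReal_def]

lemma partEnt_eq_integral {ι : Type*} [Fintype ι] [MeasurableSpace ι]
    [MeasurableSingletonClass ι] (ν : Measure X) [IsFiniteMeasure ν] {f : X → ι}
    (hf : Measurable f) :
    partEnt ν f = ∫ x, -Real.log (ν.real (f ⁻¹' {f x})) ∂ν := by
  rw [integral_comp_finite ν hf (fun i => -Real.log (ν.real (f ⁻¹' {i})))]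
  refine Finset.sum_congr rfl fun i _ => ?_
  simp [Real.negMulLog, measureReal_def]

/-- Gibbs' inequality. -/
lemma partEnt_le_integral {ι : Type*} [Fintype ι] [MeasurableSpace ι]
    [MeasurableSingletonClass ι] (ν : Measure X) [IsProbabilityMeasure ν] {f : X → ι}
    (hf : Measurable f) {q : ι → ℝ} (hq : ∀ i, 0 < q i) (hsum : ∑ i, q i ≤ 1)
    {C : X → ℝ} (hC : Integrable C ν) (h : ∀ᵐ x ∂ν, -Real.log (q (f x)) ≤ C x) :
    partEnt ν f ≤ ∫ x, C x ∂ν := by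
  have h1 : ∫ x, -Real.log (q (f x)) ∂ν ≤ ∫ x, C x ∂ν :=
    integral_mono_ae (integrable_comp_finite ν hf fun i => -Real.log (q i)) hC h
  refine le_trans ?_ h1
  rw [integral_comp_finite ν hf (fun i => -Real.log (q i))]
  have hone : ∑ i, ν.real (f ⁻¹' {i}) = 1 := by
    have := integral_comp_finite ν hf (fun _ => (1 : ℝ))
    simpa using this.symm
  have hi : ∀ i, Real.negMulLog (ν (f ⁻¹' {i})).toReal ≤
      ν.real (f ⁻¹' {i}) * -Real.log (q i) + (q i - ν.real (f ⁻¹' {i})) := by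
    intro i
    change Real.negMulLog (ν.real (f ⁻¹' {i})) ≤ _
    set a := ν.real (f ⁻¹' {i}) with ha
    rcases (measureReal_nonneg (μ := ν) (s := f ⁻¹' {i})).eq_or_lt with h0 | h0
    · rw [ha, ← h0]; simpa [Real.negMulLog] using (hq i).le
    · have h2 := Real.log_le_sub_one_of_pos (div_pos (hq i) h0)
      rw [Real.log_div (hq i).ne' h0.ne'] at h2
      have h3 := mul_le_mul_of_nonneg_left h2 h0.le
      have h4 : a * (q i / a - 1) = q i - a := by
        have : a ≠ 0 := h0.ne'
        field_simp
      rw [← ha] at h3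
      rw [Real.negMulLog]
      linarith
  calc partEnt ν f ≤ ∑ i, (ν.real (f ⁻¹' {i}) * -Real.log (q i) +
        (q i - ν.real (f ⁻¹' {i}))) := Finset.sum_le_sum fun i _ => hi i
    _ ≤ _ := by
      rw [Finset.sum_add_distrib, Finset.sum_sub_distrib, hone]
      linarith

lemma integral_sum_indicator_iterate (ν : Measure X) [IsProbabilityMeasure ν] {T : X → X}
    (hT : MeasurePreserving T ν ν) {B : Set X} (hB : MeasurableSet B) (n : ℕ) :
    Integrable (fun x => ∑ i ∈ Finset.range n, B.indicator (fun _ => (1 : ℝ)) (T^[i] x)) ν ∧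
    ∫ x, ∑ i ∈ Finset.range n, B.indicator (fun _ => (1 : ℝ)) (T^[i] x) ∂ν
      = n * ν.real B := by
  have e : ∀ i, (fun x => B.indicator (fun _ => (1 : ℝ)) (T^[i] x)) =
      (T^[i] ⁻¹' B).indicator fun _ => (1 : ℝ) := fun i => rfl
  have hm : ∀ i, MeasurableSet (T^[i] ⁻¹' B) := fun i => (hT.iterate i).measurable hB
  have hi : ∀ i, Integrable (fun x => B.indicator (fun _ => (1 : ℝ)) (T^[i] x)) ν := fun i => by
    rw [e]; exact (integrable_const 1).indicator (hm i)
  refine ⟨integrable_finsetSum _ fun i _ => hi i, ?_⟩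
  rw [integral_finsetSum _ fun i _ => hi i]
  have : ∀ i ∈ Finset.range n, ∫ x, B.indicator (fun _ => (1 : ℝ)) (T^[i] x) ∂ν = ν.real B := by
    intro i _
    rw [e, integral_indicator_const _ (hm i), smul_eq_mul, mul_one, measureReal_def,
      (hT.iterate i).measure_preimage hB.nullMeasurableSet, measureReal_def]
  rw [Finset.sum_congr rfl this]
  simp

/-- Comparison of the entropies of two labellings `P` and `Q` such that `P` is guessed from `Q`
outside a set `Δ`. -/
lemma partEnt_itinerary_le {k l : ℕ} (ν : Measure X) [IsProbabilityMeasure ν] {T : X → X}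
    (hT : MeasurePreserving T ν ν) {P : X → Fin k} (hP : Measurable P) {Q : X → Fin l}
    (hQ : Measurable Q) (guess : Fin l → Fin k) {Δ : Set X} (hΔ : MeasurableSet Δ)
    (hg : ∀ x ∉ Δ, guess (Q x) = P x) {θ : ℝ} (hθ : 0 < θ) (hθ1 : θ < 1) (n : ℕ) :
    partEnt ν (itinerary T P n) ≤ partEnt ν (itinerary T Q n) +
      n * (-Real.log (1 - θ) + ν.real Δ * Real.log (k / θ)) := by
  classical
  have hX : Nonempty X := nonempty_of_isProbabilityMeasure ν
  have hk : 0 < k := hX.elim fun x => (P x).pos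
  have hk' : (0 : ℝ) < k := by exact_mod_cast hk
  have hk1 : (1 : ℝ) ≤ k := by exact_mod_cast hk
  set κ : Fin k → Fin l → ℝ := fun i j => (if guess j = i then 1 - θ else 0) + θ / k with hκ
  have hκpos : ∀ i j, 0 < κ i j := fun i j => by
    have : 0 < θ / k := by positivity
    simp only [hκ]; split_ifs <;> linarith
  have hκsum : ∀ j, ∑ i, κ i j = 1 := fun j => by
    simp only [hκ, Finset.sum_add_distrib, Finset.sum_ite_eq, Finset.mem_univ, if_true]
    simp; field_simp; ring
  set a : (Fin n → Fin l) → ℝ := fun v => ν.real (itinerary T Q n ⁻¹' {v}) with ha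
  have hQn := measurable_itinerary hT.measurable hQ n
  have hPn := measurable_itinerary hT.measurable hP n
  have ha0 : ∀ v, 0 ≤ a v := fun v => measureReal_nonneg
  have hasum : ∑ v, a v = 1 := by
    have := integral_comp_finite ν hQn (fun _ => (1 : ℝ))
    simpa using this.symm
  set q : (Fin n → Fin k) → ℝ := fun w => ∑ v, a v * ∏ i, κ (w i) (v i) with hq
  have hqpos : ∀ w, 0 < q w := by
    intro w
    obtain ⟨v, hv⟩ : ∃ v, 0 < a v := by
      by_contra! hcon
      have : ∑ v, a v ≤ 0 := Finset.sum_nonpos fun v _ => hcon v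
      linarith
    exact Finset.sum_pos' (fun v _ => mul_nonneg (ha0 v) (Finset.prod_nonneg fun i _ =>
      (hκpos _ _).le)) ⟨v, Finset.mem_univ _, mul_pos hv (Finset.prod_pos fun i _ => hκpos _ _)⟩
  have hqsum : ∑ w, q w ≤ 1 := by
    simp only [hq]
    rw [Finset.sum_comm]
    have : ∀ v : Fin n → Fin l, ∑ w : Fin n → Fin k, a v * ∏ i, κ (w i) (v i) = a v := by
      intro v
      rw [← Finset.mul_sum]
      have := Finset.prod_univ_sum (fun _ : Fin n => (Finset.univ : Finset (Fin k)))
        (fun i b => κ b (v i))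
      rw [Fintype.piFinset_univ] at this
      rw [← this]
      simp [hκsum]
    simp [this, hasum]
  obtain ⟨hsum_int, hintv⟩ := integral_sum_indicator_iterate ν hT hΔ n
  set G : X → ℝ := fun x => ∑ i ∈ Finset.range n, Δ.indicator (fun _ => (1 : ℝ)) (T^[i] x)
  have hloga : Integrable (fun x => -Real.log (a (itinerary T Q n x))) ν :=
    integrable_comp_finite ν hQn fun v => -Real.log (a v)
  have hcost : ∀ x, -Real.log (κ (P x) (Q x)) ≤
      -Real.log (1 - θ) + Real.log (k / θ) * Δ.indicator (fun _ => (1 : ℝ)) x := by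
    intro x
    have hθk : 0 < θ / k := by positivity
    by_cases hx : x ∈ Δ
    · have h1 : Real.log (θ / k) ≤ Real.log (κ (P x) (Q x)) := by
        apply Real.log_le_log hθk
        simp only [hκ]; split_ifs <;> linarith
      have h2 : Real.log (1 - θ) ≤ 0 := Real.log_nonpos (by linarith) (by linarith)
      have h3 : Real.log (k / θ) = -Real.log (θ / k) := by
        rw [← Real.log_inv, inv_div]
      simp only [Set.indicator_of_mem hx, mul_one]
      linarith
    · have h1 : Real.log (1 - θ) ≤ Real.log (κ (P x) (Q x)) := by
        apply Real.log_le_log (by linarith)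
        simp only [hκ, hg x hx, if_true]; linarith
      simp only [Set.indicator_of_notMem hx, mul_zero]
      linarith
  have hnull : ∀ᵐ x ∂ν, 0 < a (itinerary T Q n x) := by
    have : ∀ᵐ x ∂ν, ∀ v, a v = 0 → itinerary T Q n x ≠ v := by
      rw [ae_all_iff]
      intro v
      by_cases hv : a v = 0
      · have : ν (itinerary T Q n ⁻¹' {v}) = 0 := by
          simpa [ha, measureReal_eq_zero_iff] using hv
        filter_upwards [measure_eq_zero_iff_ae_notMem.1 this] with x hx _ hxv
        exact hx hxv
      · exact ae_of_all _ fun x h => absurd h hv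
    filter_upwards [this] with x hx
    exact (ha0 _).lt_of_ne fun h => hx _ h.symm rfl
  have key := partEnt_le_integral ν hPn hqpos hqsum
    (C := fun x => -Real.log (a (itinerary T Q n x)) +
      (n * -Real.log (1 - θ) + Real.log (k / θ) * G x))
    (hloga.add ((integrable_const _).add (hsum_int.const_mul _))) (by
      filter_upwards [hnull] with x hx
      have h1 : a (itinerary T Q n x) * ∏ i : Fin n, κ (P (T^[i] x)) (Q (T^[i] x)) ≤
          q (itinerary T P n x) :=
        Finset.single_le_sum (f := fun v => a v * ∏ i, κ (itinerary T P n x i) (v i))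
          (fun v _ => mul_nonneg (ha0 v) (Finset.prod_nonneg fun i _ => (hκpos _ _).le))
          (Finset.mem_univ (itinerary T Q n x))
      have hprod : 0 < ∏ i : Fin n, κ (P (T^[i] x)) (Q (T^[i] x)) :=
        Finset.prod_pos fun i _ => hκpos _ _
      have h2 := Real.log_le_log (mul_pos hx hprod) h1
      rw [Real.log_mul hx.ne' hprod.ne', Real.log_prod fun i _ => (hκpos _ _).ne'] at h2
      have h3 : ∑ i : Fin n, -Real.log (κ (P (T^[i] x)) (Q (T^[i] x))) ≤
          n * -Real.log (1 - θ) + Real.log (k / θ) * G x := by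
        calc _ ≤ ∑ i : Fin n, (-Real.log (1 - θ) +
              Real.log (k / θ) * Δ.indicator (fun _ => (1 : ℝ)) (T^[i] x)) :=
              Finset.sum_le_sum fun i _ => hcost _
          _ = _ := by
            rw [Finset.sum_add_distrib, ← Finset.mul_sum,
              Fin.sum_univ_eq_sum_range
                (fun i => Δ.indicator (fun _ => (1 : ℝ)) (T^[i] x)) n]
            simp [G]
      rw [Finset.sum_neg_distrib] at h3
      linarith)
  have hrest : Integrable (fun x => n * -Real.log (1 - θ) + Real.log (k / θ) * G x) ν :=
    (integrable_const _).add (hsum_int.const_mul _)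
  rw [integral_add hloga hrest,
    integral_add (integrable_const (n * -Real.log (1 - θ))) (hsum_int.const_mul _),
    integral_const_mul (Real.log (k / θ)) G, hintv,
    ← partEnt_eq_integral ν hQn] at key
  simp only [integral_const, probReal_univ, smul_eq_mul, one_mul] at key
  linarith

lemma labelEntropy_le_of_guess {k l : ℕ} (ν : Measure X) [IsProbabilityMeasure ν] {T : X → X}
    (hT : MeasurePreserving T ν ν) {P : X → Fin k} (hP : Measurable P) {Q : X → Fin l}
    (hQ : Measurable Q) (guess : Fin l → Fin k) {Δ : Set X} (hΔ : MeasurableSet Δ)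
    (hg : ∀ x ∉ Δ, guess (Q x) = P x) {θ : ℝ} (hθ : 0 < θ) (hθ1 : θ < 1) :
    labelEntropy ν T P ≤ labelEntropy ν T Q +
      ENNReal.ofReal (-Real.log (1 - θ) + ν.real Δ * Real.log (k / θ)) := by
  set D := -Real.log (1 - θ) + ν.real Δ * Real.log (k / θ)
  have hle : ∀ n : ℕ, ENNReal.ofReal (partEnt ν (itinerary T P n) / n) ≤
      ENNReal.ofReal (partEnt ν (itinerary T Q n) / n) + ENNReal.ofReal D := by
    intro n
    rcases Nat.eq_zero_or_pos n with rfl | hn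
    · simp
    have hn' : (0 : ℝ) < n := by exact_mod_cast hn
    refine le_trans (ENNReal.ofReal_le_ofReal ?_) ENNReal.ofReal_add_le
    have := partEnt_itinerary_le ν hT hP hQ guess hΔ hg hθ hθ1 n
    rw [div_add' _ _ _ hn'.ne']
    apply div_le_div_of_nonneg_right _ hn'.le
    linarith
  calc labelEntropy ν T P ≤ limsup (fun n : ℕ =>
        ENNReal.ofReal (partEnt ν (itinerary T Q n) / n) + ENNReal.ofReal D) atTop :=
        limsup_le_limsup (Eventually.of_forall hle)
    _ ≤ _ := (_root_.limsup_add_const atTop _ _ (by isBoundedDefault) (by isBoundedDefault)).le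

lemma labelEntropy_le_log {k : ℕ} (ν : Measure X) [IsProbabilityMeasure ν] {T : X → X}
    (hT : Measurable T) {P : X → Fin k} (hP : Measurable P) :
    labelEntropy ν T P ≤ ENNReal.ofReal (Real.log k) := by
  have hX : Nonempty X := nonempty_of_isProbabilityMeasure ν
  have hk : 0 < k := hX.elim fun x => (P x).pos
  have hk' : (0 : ℝ) < k := by exact_mod_cast hk
  refine limsup_le_of_le (by isBoundedDefault) ?_
  filter_upwards [eventually_gt_atTop 0] with n hn
  have hn' : (0 : ℝ) < n := by exact_mod_cast hn
  apply ENNReal.ofReal_le_ofReal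
  rw [div_le_iff₀ hn']
  have := partEnt_le_integral ν (measurable_itinerary hT hP n)
    (q := fun _ => ((k : ℝ) ^ n)⁻¹) (fun _ => by positivity) (by
      simp [mul_inv_cancel₀ (pow_pos hk' n).ne']) (integrable_const (Real.log k * n))
    (ae_of_all _ fun x => by rw [Real.log_inv, Real.log_pow]; linarith)
  simpa using this

end Entropy

section Breiman

/-- Sum over all words of length `n` of a function of sequences, the sequences being completed
by the letter `a₀`. -/
def wordSum {A : Type*} [Fintype A] (a₀ : A) : ℕ → ((ℕ → A) → ℝ) → ℝ
  | 0, f => f fun _ => a₀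
  | n + 1, f => ∑ a, wordSum a₀ n fun w => f fun j => Nat.casesOn j a w

section WordSum

variable {A : Type*} [Fintype A] (a₀ : A)

lemma wordSum_eq (n : ℕ) (f : (ℕ → A) → ℝ) :
    wordSum a₀ n f = ∑ w : Fin n → A, f fun j => if h : j < n then w ⟨j, h⟩ else a₀ := by
  induction n generalizing f with
  | zero => simp [wordSum]
  | succ n ih =>
    rw [wordSum, ← (Fin.consEquiv fun _ => A).sum_comp, Fintype.sum_prod_type]
    refine Finset.sum_congr rfl fun a _ => ?_
    rw [ih]
    refine Finset.sum_congr rfl fun w _ => ?_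
    congr 1
    funext j
    cases j with
    | zero => simp [Fin.consEquiv]
    | succ j =>
      by_cases h : j < n
      · simp only [h, dif_pos (Nat.succ_lt_succ h), dif_pos]
        rfl
      · simp [h]

lemma wordSum_add (n : ℕ) (f g : (ℕ → A) → ℝ) :
    wordSum a₀ n (fun w => f w + g w) = wordSum a₀ n f + wordSum a₀ n g := by
  simp only [wordSum_eq, Finset.sum_add_distrib]

lemma wordSum_finsetSum {ι : Type*} (n : ℕ) (s : Finset ι) (f : ι → (ℕ → A) → ℝ) :
    wordSum a₀ n (fun w => ∑ i ∈ s, f i w) = ∑ i ∈ s, wordSum a₀ n (f i) := by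
  simp only [wordSum_eq]
  exact Finset.sum_comm

lemma wordSum_const_mul (n : ℕ) (c : ℝ) (f : (ℕ → A) → ℝ) :
    wordSum a₀ n (fun w => c * f w) = c * wordSum a₀ n f := by
  simp only [wordSum_eq, Finset.mul_sum]

lemma wordSum_const (n : ℕ) (c : ℝ) :
    wordSum a₀ n (fun _ => c) = (Fintype.card A : ℝ) ^ n * c := by
  classical
  simp [wordSum_eq]

lemma wordSum_mul (n m : ℕ) (g h : (ℕ → A) → ℝ)
    (hg : ∀ w w' : ℕ → A, (∀ j < n, w j = w' j) → g w = g w') :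
    wordSum a₀ (n + m) (fun w => g w * h fun j => w (j + n)) =
      wordSum a₀ n g * wordSum a₀ m h := by
  induction n generalizing g with
  | zero =>
    have : ∀ w, g w = g fun _ => a₀ := fun w => hg _ _ fun j hj => absurd hj (Nat.not_lt_zero j)
    simp only [this, wordSum_const_mul, wordSum, Nat.zero_add, Nat.add_zero]
  | succ n ih =>
    rw [Nat.succ_add]
    simp only [wordSum]
    rw [Finset.sum_mul]
    refine Finset.sum_congr rfl fun a _ => ?_
    rw [← ih]
    · rfl
    · intro w w' hw
      apply hg
      intro j hj
      cases j with
      | zero => rfl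
      | succ j => exact hw j (Nat.lt_of_succ_lt_succ hj)

end WordSum

variable [MeasurableSpace X]

/-- Existence of a sub-probability on words of length `N` giving large weight to the itineraries
of points which often start a word of large measure. -/
lemma exists_word_weight {k : ℕ} (hk : 0 < k) (ν : Measure X) [IsProbabilityMeasure ν] {T : X → X}
    (hT : Measurable T) {P : X → Fin k} (hP : Measurable P) {c η : ℝ} (hcη : 0 ≤ c + η)
    {n₀ K : ℕ} (hn₀ : 0 < n₀)
    (hsum : ∑ n ∈ Finset.Icc n₀ K, Real.exp (-(η * n)) ≤ 1 / 2) {B : Set X}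
    (hB : ∀ x ∉ B, ∃ n ∈ Finset.Icc n₀ K,
      Real.exp (-(n * c)) ≤ ν.real (itinerary T P n ⁻¹' {itinerary T P n x})) (N : ℕ) :
    ∃ q : (ℕ → Fin k) → ℝ, (∀ w, 0 < q w) ∧ wordSum (⟨0, hk⟩ : Fin k) N q ≤ 1 ∧
      (∀ w w' : ℕ → Fin k, (∀ j < N, w j = w' j) → q w = q w') ∧
      ∀ x, -Real.log (q fun j => P (T^[j] x)) ≤ N * (c + η) + Real.log (2 * k) *
        (∑ i ∈ Finset.range N, B.indicator (fun _ => (1 : ℝ)) (T^[i] x)) +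
        Real.log (2 * k) * K := by
  classical
  set a₀ : Fin k := ⟨0, hk⟩
  have hk1 : (1 : ℝ) ≤ k := by exact_mod_cast hk
  have hk' : (0 : ℝ) < k := by linarith
  set D := Real.log (2 * k) with hD
  have hDk : Real.log k ≤ D := Real.log_le_log hk' (by linarith)
  have hD0 : 0 ≤ D := (Real.log_nonneg hk1).trans hDk
  set S : ℕ → X → ℝ := fun N x =>
    ∑ i ∈ Finset.range N, B.indicator (fun _ => (1 : ℝ)) (T^[i] x) with hS
  have hind : ∀ x, 0 ≤ B.indicator (fun _ => (1 : ℝ)) x := fun x =>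
    Set.indicator_nonneg (fun _ _ => zero_le_one) x
  have hS0 : ∀ N x, 0 ≤ S N x := fun N x => Finset.sum_nonneg fun i _ => hind _
  have hSadd : ∀ n m x, S (n + m) x = S n x + S m (T^[n] x) := by
    intro n m x
    simp only [hS, Finset.sum_range_add]
    congr 1
    refine Finset.sum_congr rfl fun i _ => ?_
    rw [Nat.add_comm, Function.iterate_add_apply]
  induction N using Nat.strong_induction_on with
  | _ N ih =>
  rcases le_or_gt N K with hNK | hNK
  · refine ⟨fun _ => ((k : ℝ) ^ N)⁻¹, fun _ => by positivity, ?_, fun _ _ _ => rfl, fun x => ?_⟩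
    · rw [wordSum_const, Fintype.card_fin, mul_inv_cancel₀ (pow_pos hk' N).ne']
    · rw [Real.log_inv, Real.log_pow, neg_neg]
      have h1 : (N : ℝ) ≤ K := by exact_mod_cast hNK
      have h2 : (N : ℝ) * Real.log k ≤ K * D :=
        mul_le_mul h1 hDk (Real.log_nonneg hk1) (Nat.cast_nonneg _)
      have h3 : 0 ≤ (N : ℝ) * (c + η) := by positivity
      have h4 := mul_nonneg hD0 (hS0 N x)
      simp only [hS] at h4
      linarith
  have ih' : ∀ m, ∃ q : (ℕ → Fin k) → ℝ, m < N → (∀ w, 0 < q w) ∧ wordSum a₀ m q ≤ 1 ∧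
      (∀ w w' : ℕ → Fin k, (∀ j < m, w j = w' j) → q w = q w') ∧
      ∀ x, -Real.log (q fun j => P (T^[j] x)) ≤ m * (c + η) + D * S m x + D * K := by
    intro m
    by_cases hm : m < N
    · obtain ⟨q, hq⟩ := ih m hm
      exact ⟨q, fun _ => hq⟩
    · exact ⟨fun _ => 0, fun h => absurd h hm⟩
  choose q hq using ih'
  set μw : ℕ → (ℕ → Fin k) → ℝ :=
    fun n w => ν.real (itinerary T P n ⁻¹' {fun j : Fin n => w j}) with hμw
  have hμw0 : ∀ n w, 0 ≤ μw n w := fun n w => measureReal_nonneg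
  have hμwsum : ∀ n, wordSum a₀ n (μw n) = 1 := by
    intro n
    have := integral_comp_finite ν (measurable_itinerary hT hP n) (fun _ => (1 : ℝ))
    rw [wordSum_eq]
    simpa [hμw] using this.symm
  have hμwdep : ∀ n (w w' : ℕ → Fin k), (∀ j < n, w j = w' j) → μw n w = μw n w' := by
    intro n w w' hw
    have : (fun j : Fin n => w j) = fun j : Fin n => w' j := funext fun j => hw j j.2
    simp only [hμw, this]
  have hterm0 : ∀ n ∈ Finset.Icc n₀ K, ∀ w : ℕ → Fin k,
      0 ≤ Real.exp (-(η * n)) * μw n w * q (N - n) fun j => w (j + n) := by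
    intro n hn w
    have hn' := Finset.mem_Icc.1 hn
    exact mul_nonneg (mul_nonneg (Real.exp_pos _).le (hμw0 _ _)) ((hq (N - n) (by omega)).1 _).le
  have hfirst : ∀ w : ℕ → Fin k, 0 < (2 * k : ℝ)⁻¹ * q (N - 1) fun j => w (j + 1) := fun w =>
    mul_pos (by positivity) ((hq (N - 1) (by omega)).1 _)
  refine ⟨fun w => ((2 * k : ℝ)⁻¹ * q (N - 1) fun j => w (j + 1)) +
    ∑ n ∈ Finset.Icc n₀ K, Real.exp (-(η * n)) * μw n w * q (N - n) fun j => w (j + n),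
    fun w => add_pos_of_pos_of_nonneg (hfirst w) (Finset.sum_nonneg fun n hn => hterm0 n hn w),
    ?_, ?_, ?_⟩
  · rw [wordSum_add, wordSum_finsetSum]
    have h1 : wordSum a₀ N (fun w => (2 * k : ℝ)⁻¹ * q (N - 1) fun j => w (j + 1)) ≤ 1 / 2 := by
      have := wordSum_mul a₀ 1 (N - 1) (fun _ => (2 * k : ℝ)⁻¹) (q (N - 1)) fun _ _ _ => rfl
      rw [show 1 + (N - 1) = N by omega] at this
      rw [this, wordSum_const, Fintype.card_fin]
      have e : (k : ℝ) ^ 1 * (2 * k : ℝ)⁻¹ = 1 / 2 := by field_simp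
      rw [e]
      have := (hq (N - 1) (by omega)).2.1
      linarith
    have h2 : ∀ n ∈ Finset.Icc n₀ K, wordSum a₀ N (fun w => Real.exp (-(η * n)) * μw n w *
        q (N - n) fun j => w (j + n)) ≤ Real.exp (-(η * n)) := by
      intro n hn
      have hn' := Finset.mem_Icc.1 hn
      have := wordSum_mul a₀ n (N - n) (fun w => Real.exp (-(η * n)) * μw n w) (q (N - n))
        fun w w' hw => by rw [hμwdep n w w' hw]
      rw [show n + (N - n) = N by omega] at this
      rw [this, wordSum_const_mul, hμwsum, mul_one]
      exact mul_le_of_le_one_right (Real.exp_pos _).le (hq (N - n) (by omega)).2.1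
    have := Finset.sum_le_sum h2
    linarith
  · intro w w' hw
    refine congrArg₂ (· + ·) (congrArg (fun t => (2 * k : ℝ)⁻¹ * t) ?_) ?_
    · exact (hq (N - 1) (by omega)).2.2.1 _ _ fun j hj => hw _ (by omega)
    · refine Finset.sum_congr rfl fun n hn => ?_
      have hn' := Finset.mem_Icc.1 hn
      rw [hμwdep n w w' fun j hj => hw j (by omega),
        (hq (N - n) (by omega)).2.2.1 (fun j => w (j + n)) (fun j => w' (j + n))
          fun j hj => hw _ (by omega)]
  · intro x
    have hshift : ∀ n, (fun j => P (T^[j + n] x)) = fun j => P (T^[j] (T^[n] x)) := fun n => by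
      funext j; rw [Function.iterate_add_apply]
    by_cases hx : x ∈ B
    · have hle : (2 * k : ℝ)⁻¹ * q (N - 1) (fun j => P (T^[j] (T^[1] x))) ≤ _ :=
        le_add_of_nonneg_right (a := (2 * k : ℝ)⁻¹ * q (N - 1) (fun j => P (T^[j] (T^[1] x))))
          (Finset.sum_nonneg fun n hn => hterm0 n hn fun j => P (T^[j] x))
      have hqp := (hq (N - 1) (by omega)).1 (fun j => P (T^[j] (T^[1] x)))
      have hlog := Real.log_le_log (mul_pos (by positivity) hqp) hle
      rw [Real.log_mul (by positivity) hqp.ne', Real.log_inv] at hlog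
      have hIH := (hq (N - 1) (by omega)).2.2.2 (T^[1] x)
      have hS1 := hSadd 1 (N - 1) x
      rw [show 1 + (N - 1) = N by omega] at hS1
      have hS2 : S 1 x = 1 := by simp [hS, hx]
      have hN1 : ((N - 1 : ℕ) : ℝ) = N - 1 := by
        rw [Nat.cast_sub (by omega)]; simp
      rw [hN1] at hIH
      rw [← hshift 1] at hlog hIH
      change _ ≤ N * (c + η) + D * S N x + D * K
      rw [hS1, hS2]
      nlinarith
    · obtain ⟨n, hn, hnx⟩ := hB x hx
      have hn' := Finset.mem_Icc.1 hn
      have hle : Real.exp (-(η * n)) * μw n (fun j => P (T^[j] x)) *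
          q (N - n) (fun j => P (T^[j + n] x)) ≤ _ :=
        (Finset.single_le_sum (f := fun n : ℕ => Real.exp (-(η * n)) * μw n (fun j => P (T^[j] x)) *
          q (N - n) (fun j => P (T^[j + n] x)))
          (fun n hn => hterm0 n hn fun j => P (T^[j] x)) hn).trans
          (le_add_of_nonneg_left (hfirst fun j => P (T^[j] x)).le)
      have hqp := (hq (N - n) (by omega)).1 (fun j => P (T^[j + n] x))
      have hmu : Real.exp (-(n * c)) ≤ μw n (fun j => P (T^[j] x)) := hnx
      have hmupos := (Real.exp_pos _).trans_le hmu
      have hlog := Real.log_le_log (mul_pos (mul_pos (Real.exp_pos _) hmupos) hqp) hle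
      have hlmu := Real.log_le_log (Real.exp_pos _) hmu
      rw [Real.log_mul (mul_pos (Real.exp_pos _) hmupos).ne' hqp.ne',
        Real.log_mul (Real.exp_pos _).ne' hmupos.ne', Real.log_exp] at hlog
      rw [Real.log_exp] at hlmu
      have hIH := (hq (N - n) (by omega)).2.2.2 (T^[n] x)
      have hS1 := hSadd n (N - n) x
      rw [show n + (N - n) = N by omega] at hS1
      have hN1 : ((N - n : ℕ) : ℝ) = N - n := by
        rw [Nat.cast_sub (by omega)]
      rw [hN1, ← hshift n] at hIH
      have hS2 := mul_nonneg hD0 (hS0 n x)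
      change _ ≤ N * (c + η) + D * S N x + D * K
      rw [hS1]
      nlinarith

lemma partEnt_itinerary_le_of_word_weight {k : ℕ} (hk : 0 < k) (ν : Measure X)
    [IsProbabilityMeasure ν] {T : X → X}
    (hT : MeasurePreserving T ν ν) {P : X → Fin k} (hP : Measurable P) {c η : ℝ}
    (hcη : 0 ≤ c + η) {n₀ K : ℕ} (hn₀ : 0 < n₀)
    (hsum : ∑ n ∈ Finset.Icc n₀ K, Real.exp (-(η * n)) ≤ 1 / 2) {B : Set X}
    (hBm : MeasurableSet B)
    (hB : ∀ x ∉ B, ∃ n ∈ Finset.Icc n₀ K,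
      Real.exp (-(n * c)) ≤ ν.real (itinerary T P n ⁻¹' {itinerary T P n x})) (N : ℕ) :
    partEnt ν (itinerary T P N) ≤
      N * (c + η + Real.log (2 * k) * ν.real B) + Real.log (2 * k) * K := by
  obtain ⟨q, hq0, hq1, hqdep, hqx⟩ :=
    exists_word_weight hk ν hT.measurable hP hcη hn₀ hsum hB N
  obtain ⟨hsum_int, hintv⟩ := integral_sum_indicator_iterate ν hT hBm N
  have hC₁ := hsum_int.const_mul (Real.log (2 * k))
  have hC₂ := (integrable_const (μ := ν) ((N : ℝ) * (c + η))).add hC₁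
  have hC := hC₂.add (integrable_const (Real.log (2 * k) * K))
  have := partEnt_le_integral ν (measurable_itinerary hT.measurable hP N)
    (q := fun w => q fun j => if h : j < N then w ⟨j, h⟩ else ⟨0, hk⟩) (fun w => hq0 _)
    (by rw [← wordSum_eq]; exact hq1) hC (ae_of_all _ fun x => by
      refine le_trans (le_of_eq ?_) (hqx x)
      congr 2
      apply hqdep
      intro j hj
      simp [hj, itinerary])
  refine this.trans (le_of_eq ?_)
  rw [integral_add' hC₂ (integrable_const _), integral_add' (integrable_const _) hC₁,
    integral_const_mul (Real.log (2 * k)), hintv]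
  simp
  ring

end Breiman

section Breiman

variable [MeasurableSpace X]

lemma exists_sum_Icc_exp_le {η : ℝ} (hη : 0 < η) :
    ∃ n₀ : ℕ, 0 < n₀ ∧ ∀ K : ℕ, ∑ n ∈ Finset.Icc n₀ K, Real.exp (-(η * n)) ≤ 1 / 2 := by
  have hs : Summable fun n : ℕ => Real.exp (-(η * n)) := by
    have := summable_geometric_of_lt_one (Real.exp_pos (-η)).le (by simpa using hη)
    refine this.congr fun n => ?_
    rw [← Real.exp_nat_mul]; congr 1; ring
  obtain ⟨s, hs⟩ := summable_iff_vanishing_norm.1 hs (1 / 2) (by norm_num)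
  refine ⟨s.sup id + 1, Nat.succ_pos _, fun K => ?_⟩
  refine (le_abs_self _).trans (hs _ ?_).le
  rw [Finset.disjoint_left]
  intro n hn hns
  have h1 := Finset.le_sup (f := id) hns
  have h2 := (Finset.mem_Icc.1 hn).1
  simp only [id] at h1
  omega

/-- If almost every point has arbitrarily long itineraries of measure at least `exp (-n c)`,
the entropy is at most `c`, up to an error. -/
lemma labelEntropy_le_of_ae_frequently {k : ℕ} (ν : Measure X)
    [IsProbabilityMeasure ν] {T : X → X}
    (hT : MeasurePreserving T ν ν) {P : X → Fin k} (hP : Measurable P) {c η : ℝ} (hc : 0 ≤ c)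
    (hη : 0 < η)
    (h : ∀ᵐ x ∂ν, ∃ᶠ n : ℕ in atTop,
      Real.exp (-(n * c)) ≤ ν.real (itinerary T P n ⁻¹' {itinerary T P n x})) :
    labelEntropy ν T P ≤ ENNReal.ofReal (c + 3 * η) := by
  have hX : Nonempty X := nonempty_of_isProbabilityMeasure ν
  have hk : 0 < k := hX.elim fun x => (P x).pos
  have hk1 : (1 : ℝ) ≤ k := by exact_mod_cast hk
  obtain ⟨n₀, hn₀, hsum⟩ := exists_sum_Icc_exp_le hη
  set f : ℕ → X → ℝ := fun n x => ν.real (itinerary T P n ⁻¹' {itinerary T P n x}) with hf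
  have hfm : ∀ n, Measurable (f n) := fun n =>
    (Measurable.of_discrete (f := fun w => ν.real (itinerary T P n ⁻¹' {w}))).comp
      (measurable_itinerary hT.measurable hP n)
  set B : ℕ → Set X := fun K => {x | ∀ n ∈ Finset.Icc n₀ K, f n x < Real.exp (-(n * c))} with hB
  have hBm : ∀ K, MeasurableSet (B K) := by
    intro K
    have : B K = ⋂ n ∈ Finset.Icc n₀ K, {x | f n x < Real.exp (-(n * c))} := by
      ext x; simp [hB]
    rw [this]
    exact Finset.measurableSet_biInter _ fun n _ => measurableSet_lt (hfm n) measurable_const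
  have hanti : Antitone B := by
    intro K K' hKK x hx n hn
    exact hx n (Finset.Icc_subset_Icc_right hKK hn)
  have hlim : Tendsto (fun K => ν.real (B K)) atTop (𝓝 0) := by
    have h1 := tendsto_measure_iInter_atTop (μ := ν) (fun K => (hBm K).nullMeasurableSet) hanti
      ⟨0, measure_ne_top _ _⟩
    have h2 : ν (⋂ K, B K) = 0 := by
      rw [measure_eq_zero_iff_ae_notMem]
      filter_upwards [h] with x hx hxB
      obtain ⟨n, hn, hxn⟩ := Filter.frequently_atTop.1 hx n₀
      exact absurd hxn (not_le.2 (Set.mem_iInter.1 hxB n n (Finset.mem_Icc.2 ⟨hn, le_rfl⟩)))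
    rw [h2] at h1
    exact (ENNReal.tendsto_toReal ENNReal.zero_ne_top).comp h1
  set D := Real.log (2 * k)
  have hlim2 : Tendsto (fun K => D * ν.real (B K)) atTop (𝓝 0) := by
    simpa using hlim.const_mul D
  obtain ⟨K, hK⟩ := (hlim2.eventually (gt_mem_nhds hη)).exists
  have hgood : ∀ x ∉ B K, ∃ n ∈ Finset.Icc n₀ K, Real.exp (-(n * c)) ≤ f n x := by
    intro x hx
    simp only [hB, Set.mem_ofPred_eq] at hx
    push Not at hx
    exact hx
  refine limsup_le_of_le (by isBoundedDefault) ?_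
  have hlim3 : Tendsto (fun n : ℕ => D * K / n) atTop (𝓝 0) :=
    tendsto_const_nhds.div_atTop tendsto_natCast_atTop_atTop
  filter_upwards [eventually_gt_atTop 0, hlim3.eventually (gt_mem_nhds hη)] with n hn hn2
  have hn' : (0 : ℝ) < n := by exact_mod_cast hn
  apply ENNReal.ofReal_le_ofReal
  have := partEnt_itinerary_le_of_word_weight hk ν hT hP (c := c) (η := η) (by linarith) hn₀
    (hsum K) (hBm K) hgood n
  rw [div_lt_iff₀ hn'] at hn2
  rw [div_le_iff₀ hn']
  have h5 : (n : ℝ) * (c + η + D * ν.real (B K)) ≤ n * (c + η + η) :=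
    mul_le_mul_of_nonneg_left (by linarith) hn'.le
  linarith

/-- The lower bound in the Shannon–McMillan–Breiman theorem. -/
lemma ae_eventually_itinerary_le {k : ℕ} (ν : Measure X)
    [IsProbabilityMeasure ν] {T : X → X}
    (hT : Ergodic T ν) {P : X → Fin k} (hP : Measurable P) {c : ℝ} (hc : 0 ≤ c)
    (h : ENNReal.ofReal c < labelEntropy ν T P) :
    ∀ᵐ x ∂ν, ∀ᶠ n : ℕ in atTop,
      ν.real (itinerary T P n ⁻¹' {itinerary T P n x}) ≤ Real.exp (-(n * c)) := by
  set f : ℕ → X → ℝ := fun n x => ν.real (itinerary T P n ⁻¹' {itinerary T P n x}) with hf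
  have hfm : ∀ n, Measurable (f n) := fun n =>
    (Measurable.of_discrete (f := fun w => ν.real (itinerary T P n ⁻¹' {w}))).comp
      (measurable_itinerary hT.measurable hP n)
  have hfshift : ∀ n x, f (n + 1) x ≤ f n (T x) := by
    intro n x
    simp only [hf]
    rw [measureReal_def, measureReal_def,
      ← hT.measure_preimage ((measurable_itinerary hT.measurable hP n)
        (measurableSet_singleton _)).nullMeasurableSet]
    refine ENNReal.toReal_mono (measure_ne_top _ _) (measure_mono fun y hy => ?_)
    simp only [Set.mem_preimage, Set.mem_singleton_iff] at hy ⊢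
    funext j
    have := congrFun hy j.succ
    simpa [itinerary] using this
  set A : Set X := {x | ∃ j : ℕ, ∃ᶠ n : ℕ in atTop, Real.exp (-(n * c) - j) < f n x} with hA
  have hAm : MeasurableSet A := by
    have : A = ⋃ j : ℕ, ⋂ N : ℕ, ⋃ n : ℕ, ⋃ (_ : N ≤ n),
        {x | Real.exp (-(n * c) - j) < f n x} := by
      ext x
      simp [hA, Filter.frequently_atTop]
    rw [this]
    exact MeasurableSet.iUnion fun j => MeasurableSet.iInter fun N => MeasurableSet.iUnion
      fun n => MeasurableSet.iUnion fun _ => measurableSet_lt measurable_const (hfm n)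
  have hAsub : A ⊆ T ⁻¹' A := by
    rintro x ⟨j, hj⟩
    refine ⟨j + ⌈c⌉₊, Filter.frequently_atTop.2 fun N => ?_⟩
    obtain ⟨n, hn, hnx⟩ := Filter.frequently_atTop.1 hj (N + 1)
    obtain ⟨m, rfl⟩ : ∃ m, n = m + 1 := ⟨n - 1, by omega⟩
    refine ⟨m, by omega, lt_of_le_of_lt ?_ (hnx.trans_le (hfshift m x))⟩
    apply Real.exp_le_exp.2
    have := Nat.le_ceil c
    push_cast
    linarith
  rcases hT.ae_empty_or_univ_of_ae_le_preimage hAm.nullMeasurableSet hAsub.eventuallyLE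
    with h0 | h1
  · have : ν A = 0 := by rw [measure_congr h0]; simp
    filter_upwards [measure_eq_zero_iff_ae_notMem.1 this] with x hx
    by_contra hcon
    apply hx
    refine ⟨0, ?_⟩
    rw [Filter.not_eventually] at hcon
    refine hcon.mono fun n hn => ?_
    simpa using hn
  · exfalso
    obtain ⟨t, ht0, hct, htL⟩ := ENNReal.lt_iff_exists_real_btwn.1 h
    have hct' : c < t := by
      by_contra hcon
      exact absurd (ENNReal.ofReal_le_ofReal (not_lt.1 hcon)) (not_le.2 hct)
    set η := (t - c) / 4 with hη
    have hη0 : 0 < η := by simp only [hη]; linarith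
    have := labelEntropy_le_of_ae_frequently ν hT.toMeasurePreserving hP (c := c + η) (η := η)
      (by linarith) hη0 (by
        have hx1 : ∀ᵐ x ∂ν, x ∈ A := by
          filter_upwards [h1] with x hx
          exact hx.mpr trivial
        filter_upwards [hx1] with x hx
        obtain ⟨j, hj⟩ := hx
        have hlarge : ∀ᶠ n : ℕ in atTop, (j : ℝ) ≤ n * η := by
          filter_upwards [(tendsto_natCast_atTop_atTop (R := ℝ)).eventually_ge_atTop (j / η)]
            with n hn
          rwa [div_le_iff₀ hη0] at hn
        refine (hj.and_eventually hlarge).mono fun n hn => le_trans ?_ hn.1.le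
        apply Real.exp_le_exp.2
        linarith [hn.2])
    have h4 : c + η + 3 * η = t := by simp only [hη]; ring
    rw [h4] at this
    exact absurd this (not_le.2 htL)

end Breiman

section Flow

variable [MetricSpace X] {φ : ℝ → X → X}

lemma IsFlow.continuous_time (hφ : IsFlow φ) (t : ℝ) : Continuous (φ t) :=
  hφ.cont.comp (continuous_const.prodMk continuous_id)

lemma IsFlow.iterate (hφ : IsFlow φ) (s : ℝ) (n : ℕ) (x : X) : (φ s)^[n] x = φ (n * s) x := by
  induction n with
  | zero => simp [hφ.map_zero]
  | succ n ih =>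
    rw [Function.iterate_succ_apply', ih, ← hφ.map_add]
    congr 1
    push_cast; ring

/-- The periods of a flow without fixed points are bounded away from zero. -/
lemma exists_period_bound [CompactSpace X] (hφ : IsFlow φ) (hfp : FixedPointFree φ) :
    ∃ T₀ : ℝ, 0 < T₀ ∧ ∀ t, 0 < t → t < T₀ → ∀ x, φ t x ≠ x := by
  by_contra! hcon
  have hex : ∀ n : ℕ, ∃ t : ℝ, 0 < t ∧ t < 1 / ((n : ℝ) + 1) ∧ ∃ x, φ t x = x := fun n =>
    hcon _ (by positivity)
  choose t ht0 ht1 x hx using hex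
  obtain ⟨a, -, ψ, hψ, hlim⟩ := isCompact_univ.tendsto_subseq fun n => Set.mem_univ (x n)
  obtain ⟨s, hs⟩ := hfp a
  apply hs
  have hper : ∀ n (m : ℤ), φ (m * t n) (x n) = x n := by
    have hnat : ∀ n (m : ℕ), φ (m * t n) (x n) = x n := by
      intro n m
      induction m with
      | zero => simp [hφ.map_zero]
      | succ m ih =>
        have e : ((m + 1 : ℕ) : ℝ) * t n = m * t n + t n := by push_cast; ring
        rw [e, hφ.map_add, hx, ih]
    intro n m
    obtain ⟨m, rfl | rfl⟩ := m.eq_nat_or_neg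
    · exact_mod_cast hnat n m
    · have h := hnat n m
      have e : φ (((-(m : ℤ) : ℤ) : ℝ) * t n) (φ (m * t n) (x n)) = x n := by
        rw [← hφ.map_add]
        push_cast
        rw [neg_mul, neg_add_cancel, hφ.map_zero]
      rwa [h] at e
  set r : ℕ → ℝ := fun n => Int.fract (s / t n) * t n with hr
  have hrx : ∀ n, φ s (x n) = φ (r n) (x n) := by
    intro n
    have e : s = r n + (⌊s / t n⌋ : ℝ) * t n := by
      have h1 := Int.fract_add_floor (s / t n)
      have h2 : s = s / t n * t n := by field_simp [(ht0 n).ne']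
      simp only [hr]
      rw [← add_mul, h1, ← h2]
    conv_lhs => rw [e, hφ.map_add, hper]
  have hr0 : Tendsto r atTop (𝓝 0) := by
    refine squeeze_zero (fun n => mul_nonneg (Int.fract_nonneg _) (ht0 n).le) (fun n => ?_)
      tendsto_one_div_add_atTop_nhds_zero_nat
    exact (mul_le_of_le_one_left (ht0 n).le (Int.fract_lt_one _).le).trans (ht1 n).le
  have h1 : Tendsto (fun n => φ s (x (ψ n))) atTop (𝓝 (φ s a)) :=
    ((hφ.continuous_time s).tendsto a).comp hlim
  have h2 : Tendsto (fun n => φ (r (ψ n)) (x (ψ n))) atTop (𝓝 (φ 0 a)) :=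
    (hφ.cont.tendsto (0, a)).comp ((hr0.comp hψ.tendsto_atTop).prodMk_nhds hlim)
  rw [hφ.map_zero] at h2
  simp only [hrx] at h1
  exact tendsto_nhds_unique h1 h2

/-- Nearby orbits stay nearby during a bounded time. -/
lemma exists_dist_flow_lt [CompactSpace X] (hφ : IsFlow φ) (S : ℝ) {c : ℝ} (hc : 0 < c) :
    ∃ δ : ℝ, 0 < δ ∧ ∀ x y, dist x y < δ → ∀ t ∈ Set.Icc 0 S, dist (φ t x) (φ t y) < c := by
  have hcomp : IsCompact (Set.Icc (0 : ℝ) S ×ˢ (Set.univ : Set X)) :=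
    isCompact_Icc.prod isCompact_univ
  have hu := hcomp.uniformContinuousOn_of_continuous hφ.cont.continuousOn
  obtain ⟨δ, hδ, h⟩ := Metric.uniformContinuousOn_iff.1 hu c hc
  refine ⟨δ, hδ, fun x y hxy t ht => h (t, x) ⟨ht, trivial⟩ (t, y) ⟨ht, trivial⟩ ?_⟩
  simpa [Prod.dist_eq, hδ] using hxy

/-- Points move little during a short time. -/
lemma exists_dist_flow_self_lt [CompactSpace X] (hφ : IsFlow φ) {c : ℝ} (hc : 0 < c) :
    ∃ δ : ℝ, 0 < δ ∧ ∀ x, ∀ s t : ℝ, |s - t| < δ → dist (φ s x) (φ t x) < c := by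
  have hcomp : IsCompact (Set.Icc (-1 : ℝ) 1 ×ˢ (Set.univ : Set X)) :=
    isCompact_Icc.prod isCompact_univ
  have hu := hcomp.uniformContinuousOn_of_continuous hφ.cont.continuousOn
  obtain ⟨δ, hδ, h⟩ := Metric.uniformContinuousOn_iff.1 hu c hc
  refine ⟨min δ 1, lt_min hδ one_pos, fun x s t hst => ?_⟩
  have e : φ s x = φ (s - t) (φ t x) := by rw [← hφ.map_add]; congr 1; ring
  have e' : φ t x = φ 0 (φ t x) := (hφ.map_zero _).symm
  rw [e]
  conv_lhs => rw [e', ← e']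
  have hst1 := (lt_min_iff.1 hst)
  have := h (s - t, φ t x) ⟨⟨by linarith [(abs_lt.1 hst1.2).1], (abs_lt.1 hst1.2).2.le⟩, trivial⟩
    (0, φ t x) ⟨⟨by norm_num, by norm_num⟩, trivial⟩ (by
      simpa [Prod.dist_eq, hδ] using hst1.1)
  simpa [hφ.map_zero] using this

/-- For a flow without fixed points, reparametrizations along which two orbits stay close
are close to translations during bounded times. -/
lemma exists_repar_drift_lt [CompactSpace X] (hφ : IsFlow φ) (hfp : FixedPointFree φ)
    (S : ℝ) {κ : ℝ}
    (hκ : 0 < κ) :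
    ∃ ε₀ : ℝ, 0 < ε₀ ∧ ∀ (x y : X) (α : ℝ → ℝ) (a b : ℝ), a ≤ b → b - a ≤ S →
      ContinuousOn α (Set.Icc a b) →
      (∀ s ∈ Set.Icc a b, dist (φ (α s) x) (φ s y) < ε₀) → |α b - α a - (b - a)| < κ := by
  rcases isEmpty_or_nonempty X with hX | hX
  · exact ⟨1, one_pos, fun x => isEmptyElim x⟩
  obtain ⟨T₀, hT₀, hper⟩ := exists_period_bound hφ hfp
  set k := min κ (T₀ / 2) with hk
  have hk0 : 0 < k := lt_min hκ (by linarith)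
  have hkT : k < T₀ := (min_le_right _ _).trans_lt (by linarith)
  obtain ⟨v₀, -, hv₀⟩ := isCompact_univ.exists_isMinOn (Set.univ_nonempty (α := X))
    ((hφ.continuous_time k).dist continuous_id).continuousOn
  set c := dist (φ k v₀) v₀ with hc
  have hc0 : 0 < c := dist_pos.2 (hper k hk0 hkT v₀)
  have hmin : ∀ v, c ≤ dist (φ k v) v := fun v => hv₀ (Set.mem_univ v)
  have hmin' : ∀ v, c ≤ dist (φ (-k) v) v := fun v => by
    have := hmin (φ (-k) v)
    rw [← hφ.map_add, add_neg_cancel, hφ.map_zero, dist_comm] at this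
    exact this
  obtain ⟨δ, hδ, hclose⟩ := exists_dist_flow_lt hφ S (half_pos hc0)
  refine ⟨min δ (c / 2), lt_min hδ (half_pos hc0), fun x y α a b hab hbS hα hd => ?_⟩
  set f : ℝ → ℝ := fun s => α s - α a - (s - a) with hf
  have hfc : ContinuousOn f (Set.Icc a b) :=
    (hα.sub continuousOn_const).sub (continuousOn_id.sub continuousOn_const)
  have hfa : f a = 0 := by simp [hf]
  have hne : ∀ s ∈ Set.Icc a b,
      dist (φ (f s) (φ (s - a) (φ (α a) x))) (φ (s - a) (φ (α a) x)) < c := by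
    intro s hs
    have e1 : φ (f s) (φ (s - a) (φ (α a) x)) = φ (α s) x := by
      rw [← hφ.map_add, ← hφ.map_add]; congr 1; simp only [hf]; ring
    have e2 : φ s y = φ (s - a) (φ a y) := by rw [← hφ.map_add]; congr 1; ring
    have h1 := hd s hs
    have h2 := hclose _ _ ((hd a ⟨le_rfl, hab⟩).trans_le (min_le_left _ _)) (s - a)
      ⟨by linarith [hs.1], by linarith [hs.2]⟩
    rw [← e2] at h2
    rw [e1]
    have := dist_triangle (φ (α s) x) (φ s y) (φ (s - a) (φ (α a) x))
    rw [dist_comm (φ s y)] at this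
    have := h1.trans_le (min_le_right _ _)
    linarith
  have habs : |f b| < k := by
    by_contra hcon
    rw [not_lt, le_abs] at hcon
    rcases hcon with h | h
    · obtain ⟨s, hs, hfs⟩ := intermediate_value_Icc hab hfc ⟨hfa.trans_le hk0.le, h⟩
      have := hne s hs
      rw [hfs] at this
      exact absurd this (not_lt.2 (hmin _))
    · obtain ⟨s, hs, hfs⟩ := intermediate_value_Icc' hab hfc
        (show -k ∈ Set.Icc (f b) (f a) from ⟨by linarith, by rw [hfa]; linarith⟩)
      have := hne s hs
      rw [hfs] at this
      exact absurd this (not_lt.2 (hmin' _))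
  exact habs.trans_le (min_le_left _ _)

lemma isOpen_reparBall_prod (hφ : IsFlow φ) (t ε : ℝ) :
    IsOpen {p : X × X | p.2 ∈ reparBall φ p.1 t ε} := by
  have : {p : X × X | p.2 ∈ reparBall φ p.1 t ε} = ⋃ (α : ℝ → ℝ) (_ : IsReparOn α (Set.Icc 0 t)),
      {p : X × X | ∀ s : Set.Icc (0 : ℝ) t, dist (φ (α s) p.1) (φ s p.2) < ε} := by
    ext p
    simp [reparBall]
  rw [this]
  refine isOpen_iUnion fun α => isOpen_iUnion fun hα => ?_
  have hα' : Continuous fun s : Set.Icc (0 : ℝ) t => α s := hα.1.domRestrict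
  have hc : Continuous fun z : (X × X) × Set.Icc (0 : ℝ) t =>
      dist (φ (α z.2) z.1.1) (φ z.2 z.1.2) :=
    (hφ.cont.comp ((hα'.comp continuous_snd).prodMk (continuous_fst.comp continuous_fst))).dist
      (hφ.cont.comp ((continuous_subtype_val.comp continuous_snd).prodMk
        (continuous_snd.comp continuous_fst)))
  rw [isOpen_iff_mem_nhds]
  intro p hp
  have := isCompact_univ.eventually_forall_of_forall_eventually (x₀ := p)
    (P := fun (p : X × X) (s : Set.Icc (0 : ℝ) t) => dist (φ (α s) p.1) (φ s p.2) < ε)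
    fun s _ => hc.continuousAt.eventually_lt continuousAt_const (hp s)
  filter_upwards [this] with q hq s
  exact hq s trivial

lemma measurable_localRate [CompactSpace X] [MeasurableSpace X] [BorelSpace X]
    (hφ : IsFlow φ) (μ : Measure X)
    [IsFiniteMeasure μ] (t ε : ℝ) : Measurable fun x => localRate μ φ x ε t := by
  have h1 : Measurable fun x => μ (reparBall φ x t ε) :=
    measurable_measure_prodMk_left (isOpen_reparBall_prod hφ t ε).measurableSet
  have h2 : Measurable negLogNN :=
    Measurable.ite (measurableSet_singleton 0) measurable_const
      (ENNReal.measurable_ofReal.comp (Real.measurable_log.comp ENNReal.measurable_toReal).neg)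
  exact (h2.comp h1).div_const _

lemma measurableSet_reparBall [MeasurableSpace X] [BorelSpace X] (hφ : IsFlow φ) (x : X)
    (t ε : ℝ) : MeasurableSet (reparBall φ x t ε) :=
  ((isOpen_reparBall_prod hφ t ε).preimage (Continuous.prodMk_right x)).measurableSet

end Flow

section Counting

variable [MetricSpace X] {φ : ℝ → X → X}

/-- A map of small drift passes through successive multiples of `s₀` at times whose gaps
are close to `s₀`. -/
lemma exists_times_of_drift {α : ℝ → ℝ} {s₀ κ r : ℝ} {m n : ℕ} (hs₀ : 0 < s₀)
    (hκs : κ ≤ s₀) (hκr : κ ≤ s₀ * r) (hmn : (m : ℝ) * (1 + r) + 2 ≤ n) (hr : 0 < r)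
    (hα : ContinuousOn α (Set.Icc 0 (n * s₀))) (hα0 : α 0 = 0)
    (hd : ∀ a b, 0 ≤ a → a ≤ b → b ≤ n * s₀ → b - a ≤ 2 * s₀ → |α b - α a - (b - a)| < κ) :
    ∃ s : ℕ → ℝ, s 0 = 0 ∧ (∀ j ≤ m, 0 ≤ s j ∧ s j ≤ n * s₀ ∧ α (s j) = j * s₀) ∧
      ∀ j < m, s j ≤ s (j + 1) ∧ |s (j + 1) - s j - s₀| < κ := by
  have hle : ∀ j : ℕ, j ≤ m → (j : ℝ) * (s₀ + κ) + 2 * s₀ ≤ n * s₀ := by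
    intro j hj
    have hj' : (j : ℝ) ≤ m := by exact_mod_cast hj
    have hj0 : (0 : ℝ) ≤ j := j.cast_nonneg
    nlinarith [mul_le_mul_of_nonneg_right hmn hs₀.le, mul_le_mul_of_nonneg_left hκr hj0,
      mul_le_mul_of_nonneg_right hj' (show 0 ≤ s₀ * (1 + r) by positivity)]
  have step : ∀ (j : ℕ) (u : ℝ), ∃ u', j < m → 0 ≤ u → u ≤ j * (s₀ + κ) → α u = j * s₀ →
      u ≤ u' ∧ |u' - u - s₀| < κ ∧ α u' = (j + 1) * s₀ := by
    intro j u
    by_cases hcond : j < m ∧ 0 ≤ u ∧ u ≤ j * (s₀ + κ) ∧ α u = j * s₀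
    · obtain ⟨hj, hu, huj, hαu⟩ := hcond
      have hn := hle j hj.le
      have h2 := hd u (u + 2 * s₀) hu (by linarith) (by linarith) (by linarith)
      rw [abs_lt] at h2
      obtain ⟨u', ⟨hu1, hu2⟩, hu'⟩ := intermediate_value_Icc (show u ≤ u + 2 * s₀ by linarith)
        (hα.mono (Set.Icc_subset_Icc hu (by linarith)))
        (show (j + 1 : ℝ) * s₀ ∈ Set.Icc (α u) (α (u + 2 * s₀)) from
          ⟨by linarith, by linarith [h2.1]⟩)
      refine ⟨u', fun _ _ _ _ => ⟨hu1, ?_, hu'⟩⟩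
      have h3 := hd u u' hu hu1 (by linarith) (by linarith)
      rw [hu', hαu, abs_sub_comm] at h3
      convert h3 using 2
      ring
    · exact ⟨0, fun h1 h2 h3 h4 => absurd ⟨h1, h2, h3, h4⟩ hcond⟩
  choose F hF using step
  let s : ℕ → ℝ := fun j => Nat.rec 0 (fun j u => F j u) j
  have hs : ∀ j ≤ m, 0 ≤ s j ∧ s j ≤ j * (s₀ + κ) ∧ α (s j) = j * s₀ := by
    intro j
    induction j with
    | zero => intro _; simp [s, hα0]
    | succ j ih =>
      intro hj
      obtain ⟨h1, h2, h3⟩ := ih (by omega)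
      obtain ⟨h4, h5, h6⟩ := hF j (s j) (by omega) h1 h2 h3
      change 0 ≤ F j (s j) ∧ F j (s j) ≤ _ ∧ α (F j (s j)) = _
      rw [abs_lt] at h5
      push_cast
      exact ⟨h1.trans h4, by linarith, h6⟩
  refine ⟨s, rfl, fun j hj => ?_, fun j hj => ?_⟩
  · obtain ⟨h1, h2, h3⟩ := hs j hj
    exact ⟨h1, by linarith [hle j hj], h3⟩
  · obtain ⟨h1, h2, h3⟩ := hs j hj.le
    obtain ⟨h4, h5, -⟩ := hF j (s j) hj h1 h2 h3
    exact ⟨h4, h5⟩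

/-- For a labelling with separated nonzero labels, the itineraries of length `m` of the points
whose reparametrization ball meets a given one are at most `6 ^ m` in number. -/
lemma exists_card_itinerary_le [CompactSpace X] (hφ : IsFlow φ) (hfp : FixedPointFree φ)
    {s₀ : ℝ} (hs₀ : 0 < s₀) {k : ℕ} (Q : X → Fin (k + 1)) {e : ℝ} (he : 0 < e)
    (hQ : ∀ x y, Q x ≠ 0 → Q y ≠ 0 → Q x ≠ Q y → e ≤ dist x y) {r : ℝ} (hr : 0 < r) :
    ∃ ε₀ : ℝ, 0 < ε₀ ∧ ∀ ε < ε₀, ∀ (z : X) (m n : ℕ), (m : ℝ) * (1 + r) + 2 ≤ n →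
      ∃ N : Finset (Fin m → Fin (k + 1)), N.card ≤ 6 ^ m ∧
        ∀ x, (reparBall φ x (n * s₀) ε ∩ reparBall φ z (n * s₀) ε).Nonempty →
          itinerary (φ s₀) Q m x ∈ N := by
  classical
  obtain ⟨δ, hδ, hmove⟩ := exists_dist_flow_self_lt hφ (show 0 < e / 8 by positivity)
  obtain ⟨c, hc⟩ := exists_nat_gt (s₀ / δ)
  have hc0 : (0 : ℝ) < c := (div_pos hs₀ hδ).trans hc
  set g := s₀ / c with hg
  have hg0 : 0 < g := div_pos hs₀ hc0
  have hgδ : g < δ := by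
    rw [hg, div_lt_iff₀ hc0]
    rwa [div_lt_iff₀ hδ, mul_comm] at hc
  have hcg : s₀ = c * g := by rw [hg]; field_simp
  set κ := min (min s₀ (s₀ * r)) (g / 2) with hκ
  have hκ0 : 0 < κ := lt_min (lt_min hs₀ (by positivity)) (by positivity)
  obtain ⟨ε₀, hε₀, hdrift⟩ := exists_repar_drift_lt hφ hfp (2 * s₀) hκ0
  refine ⟨min ε₀ (e / 8), lt_min hε₀ (by positivity), fun ε hε z m n hmn => ?_⟩
  have hεd : ε < ε₀ := hε.trans_le (min_le_left _ _)
  have hεe : ε < e / 8 := hε.trans_le (min_le_right _ _)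
  have hκs : κ ≤ s₀ := (min_le_left _ _).trans (min_le_left _ _)
  have hκr : κ ≤ s₀ * r := (min_le_left _ _).trans (min_le_right _ _)
  have hκg : 2 * κ ≤ g := by linarith [min_le_right (min s₀ (s₀ * r)) (g / 2)]
  let near : ℤ → X → Prop := fun i u => dist u (φ (i * g) z) < 3 * (e / 8) ∧ Q u ≠ 0
  let pos : ℤ → Fin (k + 1) := fun i => if h : ∃ u, near i u then Q h.choose else 0
  have hpos : ∀ i u, near i u → pos i = Q u := by
    intro i u hu
    have h : ∃ u, near i u := ⟨u, hu⟩
    simp only [pos, dif_pos h]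
    by_contra hne
    have h1 := hQ _ _ h.choose_spec.2 hu.2 hne
    have h2 := dist_triangle_right h.choose u (φ (i * g) z)
    linarith [h.choose_spec.1, hu.1]
  let W : (Fin m → Fin 3) → ℕ → ℤ := fun w J =>
    ∑ i ∈ Finset.range J, ((c : ℤ) + (if h : i < m then ((w ⟨i, h⟩ : ℕ) : ℤ) else 0) - 1)
  let Φ : (Fin m → Fin 3) × (Fin m → Bool) → (Fin m → Fin (k + 1)) := fun v j =>
    if v.2 j then pos (W v.1 j) else 0
  refine ⟨Finset.univ.image Φ, Finset.card_image_le.trans ?_, ?_⟩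
  · simp [← mul_pow]
  rintro x ⟨y, ⟨α, ⟨hαc, -, hα0⟩, hα⟩, ⟨β, ⟨hβc, -, hβ0⟩, hβ⟩⟩
  have drift : ∀ (γ : ℝ → ℝ) (v : X), ContinuousOn γ (Set.Icc 0 (n * s₀)) →
      (∀ s ∈ Set.Icc (0 : ℝ) (n * s₀), dist (φ (γ s) v) (φ s y) < ε) →
      ∀ a b, 0 ≤ a → a ≤ b → b ≤ n * s₀ → b - a ≤ 2 * s₀ → |γ b - γ a - (b - a)| < κ := by
    intro γ v hγc hγ a b ha hab hb hba
    have hsub : Set.Icc a b ⊆ Set.Icc 0 (n * s₀) := Set.Icc_subset_Icc ha hb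
    exact hdrift v y γ a b hab hba (hγc.mono hsub) fun s hs => (hγ s (hsub hs)).trans hεd
  obtain ⟨s, hs0, hs, hs'⟩ := exists_times_of_drift hs₀ hκs hκr hmn hr hαc hα0
    (drift α x hαc hα)
  set b : ℕ → ℝ := fun j => β (s j) / g with hb
  have hfl : ∀ j < m, ⌊b j⌋ + c - 1 ≤ ⌊b (j + 1)⌋ ∧ ⌊b (j + 1)⌋ ≤ ⌊b j⌋ + c + 1 := by
    intro j hj
    obtain ⟨h1, h2⟩ := hs' j hj
    obtain ⟨h3, -, -⟩ := hs j hj.le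
    obtain ⟨-, h4, -⟩ := hs (j + 1) hj
    have h2' := abs_lt.1 h2
    have h5 := abs_lt.1 (drift β z hβc hβ _ _ h3 h1 h4 (by linarith [h2'.2]))
    have hbg : ∀ j, b j * g = β (s j) := fun j => by simp only [hb]; field_simp
    have h6 : b (j + 1) < b j + (c + 1) := by
      refine lt_of_mul_lt_mul_right ?_ hg0.le
      rw [add_mul, add_mul, hbg, hbg, ← hcg]
      linarith [h5.2, h2'.2]
    have h7 : b j + (c - 1) < b (j + 1) := by
      refine lt_of_mul_lt_mul_right ?_ hg0.le
      rw [add_mul, sub_mul, hbg, hbg, ← hcg]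
      linarith [h5.1, h2'.1]
    constructor
    · rw [Int.le_floor]
      push_cast
      linarith [Int.floor_le (b j)]
    · rw [← Int.lt_add_one_iff, Int.floor_lt]
      push_cast
      linarith [Int.lt_floor_add_one (b j)]
  let w : Fin m → Fin 3 := fun j =>
    ⟨(⌊b (j + 1)⌋ - ⌊b j⌋ - c + 1).toNat, by have := hfl j j.2; omega⟩
  have hW : ∀ J ≤ m, W w J = ⌊b J⌋ := by
    intro J
    induction J with
    | zero => intro _; simp [W, hb, hs0, hβ0]
    | succ J ih =>
      intro hJ
      have h := hfl J (by omega)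
      simp only [W] at ih ⊢
      rw [Finset.sum_range_succ, ih (by omega), dif_pos (by omega)]
      simp only [w]
      omega
  rw [Finset.mem_image]
  refine ⟨(w, fun j => decide (Q (φ (j * s₀) x) ≠ 0)), Finset.mem_univ _, ?_⟩
  ext1 j
  simp only [Φ, itinerary, hφ.iterate]
  by_cases h0 : Q (φ (j * s₀) x) = 0
  · simp [h0]
  · rw [if_pos (by simpa using h0)]
    refine hpos _ _ ⟨?_, h0⟩
    obtain ⟨h1, h2, h3⟩ := hs j j.2.le
    have h4 := hα (s j) ⟨h1, h2⟩
    have h5 := hβ (s j) ⟨h1, h2⟩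
    rw [h3] at h4
    have h6 := hmove z (β (s j)) (⌊b j⌋ * g) (by
      have hbg : b j * g = β (s j) := by simp only [hb]; field_simp
      rw [← hbg, ← sub_mul, abs_of_nonneg (mul_nonneg (by linarith [Int.floor_le (b j)]) hg0.le)]
      refine lt_of_le_of_lt ?_ hgδ
      exact mul_le_of_le_one_left hg0.le (by linarith [Int.lt_floor_add_one (b j)]))
    rw [hW j j.2.le]
    have := dist_triangle4 (φ (j * s₀) x) (φ (s j) y) (φ (β (s j)) z) (φ (⌊b j⌋ * g) z)
    rw [dist_comm (φ (s j) y)] at this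
    linarith

end Counting

section LocalBound

/-- A covering estimate: points carrying a `μ`-heavy set `B x` and lying in a `ν`-light cell of
`f` form a set of small `ν`-measure, if every `B z` meets the sets `B x` of few cells only. -/
lemma measure_heavy_light_le [MeasurableSpace X] {ι : Type*} (μ ν : Measure X)
    [IsProbabilityMeasure μ] [IsProbabilityMeasure ν] {B : X → Set X}
    (hB : ∀ x, MeasurableSet (B x)) (f : X → ι) {K : ℕ}
    (hK : ∀ z, ∃ N : Finset ι, N.card ≤ K ∧ ∀ x, (B x ∩ B z).Nonempty → f x ∈ N) (a c : ℝ) :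
    ν {x | Real.exp (-a) ≤ μ.real (B x) ∧ ν.real (f ⁻¹' {f x}) ≤ Real.exp (-c)} ≤
      ENNReal.ofReal (Real.exp a * K * Real.exp (-c)) := by
  classical
  let good : Finset X → Prop := fun D =>
    (∀ d ∈ D, Real.exp (-a) ≤ μ.real (B d)) ∧ (D : Set X).PairwiseDisjoint B
  have hcard : ∀ D, good D → (D.card : ℝ) ≤ Real.exp a := by
    rintro D ⟨h1, h2⟩
    have h3 : (D.card : ℝ) * Real.exp (-a) ≤ 1 := by
      calc (D.card : ℝ) * Real.exp (-a) = ∑ d ∈ D, Real.exp (-a) := by simp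
        _ ≤ ∑ d ∈ D, μ.real (B d) := Finset.sum_le_sum h1
        _ = μ.real (⋃ d ∈ D, B d) :=
          (measureReal_biUnion_finset (fun i hi j hj hij => h2 hi hj hij) fun d _ => hB d).symm
        _ ≤ 1 := measureReal_le_one
    rw [Real.exp_neg, ← div_eq_mul_inv, div_le_one (Real.exp_pos _)] at h3
    exact h3
  obtain ⟨D, hD, hmax⟩ : ∃ D, good D ∧ ∀ D', good D' → D'.card ≤ D.card := by
    have hne : {n | ∃ D, good D ∧ D.card = n}.Nonempty := ⟨0, ∅, by simp [good], rfl⟩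
    have hbd : BddAbove {n | ∃ D, good D ∧ D.card = n} := by
      refine ⟨⌊Real.exp a⌋₊, ?_⟩
      rintro n ⟨D, hD, rfl⟩
      exact Nat.le_floor (hcard D hD)
    obtain ⟨D, hD, hDc⟩ := Nat.sSup_mem hne hbd
    exact ⟨D, hD, fun D' hD' => hDc ▸ le_csSup hbd ⟨D', hD', rfl⟩⟩
  have hmeet : ∀ x, Real.exp (-a) ≤ μ.real (B x) → ∃ d ∈ D, (B x ∩ B d).Nonempty := by
    intro x hx
    by_contra! hcon
    have hBx : (B x).Nonempty := by
      rw [Set.nonempty_iff_ne_empty]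
      intro h
      rw [h, measureReal_empty] at hx
      exact absurd hx (not_le.2 (Real.exp_pos _))
    have hxD : x ∉ D := fun h => by
      have := hcon x h
      rw [Set.inter_self] at this
      exact hBx.ne_empty this
    have hgood : good (insert x D) := by
      refine ⟨?_, ?_⟩
      · intro d hd
        rcases Finset.mem_insert.1 hd with rfl | hd
        · exact hx
        · exact hD.1 d hd
      · rw [Finset.coe_insert]
        exact hD.2.insert fun d hd _ => Set.disjoint_iff_inter_eq_empty.2 (hcon d hd)
    have := hmax _ hgood
    rw [Finset.card_insert_of_notMem hxD] at this
    omega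
  choose N hN hN' using hK
  let W : Finset ι := D.biUnion fun d => (N d).filter fun w => ν.real (f ⁻¹' {w}) ≤ Real.exp (-c)
  have hsub : {x | Real.exp (-a) ≤ μ.real (B x) ∧ ν.real (f ⁻¹' {f x}) ≤ Real.exp (-c)} ⊆
      ⋃ w ∈ W, f ⁻¹' {w} := by
    rintro x ⟨h1, h2⟩
    obtain ⟨d, hd, hxd⟩ := hmeet x h1
    simp only [Set.mem_iUnion]
    exact ⟨f x, Finset.mem_biUnion.2 ⟨d, hd, Finset.mem_filter.2 ⟨hN' d x hxd, h2⟩⟩, rfl⟩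
  have hWcard : (W.card : ℝ) ≤ Real.exp a * K := by
    have h1 : W.card ≤ D.card * K := Finset.card_biUnion_le_card_mul _ _ _ fun d _ =>
      (Finset.card_filter_le _ _).trans (hN d)
    calc (W.card : ℝ) ≤ D.card * K := by exact_mod_cast h1
      _ ≤ Real.exp a * K := mul_le_mul_of_nonneg_right (hcard D hD) (Nat.cast_nonneg _)
  calc ν _ ≤ ν (⋃ w ∈ W, f ⁻¹' {w}) := measure_mono hsub
    _ ≤ ∑ w ∈ W, ν (f ⁻¹' {w}) := measure_biUnion_finset_le _ _
    _ ≤ ∑ w ∈ W, ENNReal.ofReal (Real.exp (-c)) := by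
      refine Finset.sum_le_sum fun w hw => ?_
      obtain ⟨d, -, hw⟩ := Finset.mem_biUnion.1 hw
      rw [← ofReal_measureReal]
      exact ENNReal.ofReal_le_ofReal (Finset.mem_filter.1 hw).2
    _ = ENNReal.ofReal (W.card * Real.exp (-c)) := by
      rw [Finset.sum_const, nsmul_eq_mul, ENNReal.ofReal_mul (Nat.cast_nonneg _),
        ENNReal.ofReal_natCast]
    _ ≤ _ := ENNReal.ofReal_le_ofReal (mul_le_mul_of_nonneg_right hWcard (Real.exp_pos _).le)

lemma le_localRate [PseudoMetricSpace X] [MeasurableSpace X] {μ : Measure X}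
    [IsFiniteMeasure μ] {φ : ℝ → X → X} {x : X} {ε t a : ℝ} (ht : 0 < t)
    (h : μ.real (reparBall φ x t ε) < Real.exp (-(t * a))) :
    ENNReal.ofReal a ≤ localRate μ φ x ε t := by
  have ht' : ENNReal.ofReal t ≠ 0 := by simpa using ht
  rw [localRate, ENNReal.le_div_iff_mul_le (Or.inl ht') (Or.inl ENNReal.ofReal_ne_top), negLogNN]
  split_ifs with h0
  · exact le_top
  · rw [← ENNReal.ofReal_mul' ht.le]
    refine ENNReal.ofReal_le_ofReal ?_
    have hpos := ENNReal.toReal_pos h0 (measure_ne_top _ _)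
    have := (Real.log_lt_iff_lt_exp hpos).2 h
    linarith

/-- Almost everywhere lower bound of the local rate by the entropy of a separated labelling. -/
lemma ae_labelEntropy_le_liminf_localRate [MetricSpace X] [CompactSpace X] [MeasurableSpace X]
    [BorelSpace X] {φ : ℝ → X → X} (hφ : IsFlow φ) (hfp : FixedPointFree φ)
    {s₀ : ℝ} (hs₀ : 0 < s₀) {k : ℕ} {Q : X → Fin (k + 1)} (hQm : Measurable Q)
    {e : ℝ} (he : 0 < e)
    (hQ : ∀ x y, Q x ≠ 0 → Q y ≠ 0 → Q x ≠ Q y → e ≤ dist x y) {η : ℝ} (hη : 0 < η) :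
    ∃ ε₀ : ℝ, 0 < ε₀ ∧ ∀ ε < ε₀, ∀ (μ ν : Measure X) [IsProbabilityMeasure μ]
      [IsProbabilityMeasure ν], Ergodic (φ s₀) ν → ∀ᵐ x ∂ν,
        labelEntropy ν (φ s₀) Q ≤ ENNReal.ofReal (Real.log 6 + 2 * η) + ENNReal.ofReal s₀ *
          Filter.liminf (fun n : ℕ => localRate μ φ x ε ((n : ℝ) * s₀)) Filter.atTop := by
  have hlogk : 0 ≤ Real.log ((k + 1 : ℕ) : ℝ) := Real.log_natCast_nonneg _
  set r := η / (2 * (Real.log ((k + 1 : ℕ) : ℝ) + 2 * η)) with hr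
  have hr0 : 0 < r := by positivity
  obtain ⟨ε₀, hε₀, hcount⟩ := exists_card_itinerary_le hφ hfp hs₀ Q he hQ hr0
  refine ⟨ε₀, hε₀, fun ε hε μ ν _ _ hT => ?_⟩
  have hHtop : labelEntropy ν (φ s₀) Q ≤ ENNReal.ofReal (Real.log ((k + 1 : ℕ) : ℝ)) :=
    labelEntropy_le_log ν hT.measurable hQm
  have hne : labelEntropy ν (φ s₀) Q ≠ ⊤ := ne_top_of_le_ne_top ENNReal.ofReal_ne_top hHtop
  set H := (labelEntropy ν (φ s₀) Q).toReal with hH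
  have hHle : H ≤ Real.log ((k + 1 : ℕ) : ℝ) := ENNReal.toReal_le_of_le_ofReal hlogk hHtop
  have hHeq : labelEntropy ν (φ s₀) Q = ENNReal.ofReal H := (ENNReal.ofReal_toReal hne).symm
  have hlog6 : 0 < Real.log 6 := Real.log_pos (by norm_num)
  rcases le_or_gt H (Real.log 6 + 2 * η) with hsmall | hbig
  · refine Eventually.of_forall fun x => ?_
    rw [hHeq]
    exact (ENNReal.ofReal_le_ofReal hsmall).trans le_self_add
  set a := H - Real.log 6 - 2 * η with ha
  have ha0 : 0 < a := by linarith
  set b := a + 3 / 2 * η with hb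
  have hrb : r * b ≤ η / 2 := by
    have : r * (Real.log ((k + 1 : ℕ) : ℝ) + 2 * η) = η / 2 := by rw [hr]; field_simp
    rw [← this]
    exact mul_le_mul_of_nonneg_left (by linarith) hr0.le
  have hb0 : 0 < b := by positivity
  let m : ℕ → ℕ := fun n => ⌊((n : ℝ) - 2) / (1 + r)⌋₊
  have hm1 : ∀ n, 2 ≤ n → (m n : ℝ) * (1 + r) + 2 ≤ n := by
    intro n hn
    have hn' : (2 : ℝ) ≤ n := by exact_mod_cast hn
    have := Nat.floor_le (show 0 ≤ ((n : ℝ) - 2) / (1 + r) from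
      div_nonneg (by linarith) (by positivity))
    rw [le_div_iff₀ (by positivity)] at this
    linarith
  have hm2 : ∀ n : ℕ, 2 ≤ n → (n : ℝ) * (1 - r) - 3 ≤ m n := by
    intro n hn
    have hn' : (2 : ℝ) ≤ n := by exact_mod_cast hn
    have h1 := (Nat.lt_floor_add_one (((n : ℝ) - 2) / (1 + r))).le
    rw [div_le_iff₀ (by positivity)] at h1
    change (n : ℝ) - 2 ≤ ((m n : ℝ) + 1) * (1 + r) at h1
    have h2 : (m n : ℝ) + 1 ≤ n := by nlinarith [hm1 n hn, (m n).cast_nonneg (α := ℝ)]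
    nlinarith [mul_le_mul_of_nonneg_right h2 hr0.le]
  have hmtop : Tendsto m atTop atTop := by
    refine tendsto_nat_floor_atTop.comp ?_
    exact (tendsto_atTop_add_const_right _ _ tendsto_natCast_atTop_atTop).atTop_div_const
      (by positivity)
  have hcyl := ae_eventually_itinerary_le ν hT hQm (c := b + Real.log 6) (by positivity) (by
    rw [hHeq]
    exact (ENNReal.ofReal_lt_ofReal_iff (by linarith)).2 (by linarith))
  let S : ℕ → Set X := fun n => {x | 2 ≤ n ∧
    Real.exp (-(n * a)) ≤ μ.real (reparBall φ x (n * s₀) ε) ∧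
    ν.real (itinerary (φ s₀) Q (m n) ⁻¹' {itinerary (φ s₀) Q (m n) x}) ≤
      Real.exp (-(m n * (b + Real.log 6)))}
  have hSle : ∀ n, ν (S n) ≤ ENNReal.ofReal (Real.exp (3 * b) * Real.exp (-η) ^ n) := by
    intro n
    rcases lt_or_ge n 2 with hn | hn
    · have : S n = ∅ := by
        ext x
        simp [S, not_le.2 hn]
      simp [this]
    · refine (measure_mono fun x hx => hx.2).trans ((measure_heavy_light_le μ ν
        (fun x => measurableSet_reparBall hφ x (n * s₀) ε) (itinerary (φ s₀) Q (m n))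
        (fun z => hcount ε hε z (m n) n (hm1 n hn)) _ _).trans
        (ENNReal.ofReal_le_ofReal ?_))
      have h6 : ((6 ^ m n : ℕ) : ℝ) = Real.exp (m n * Real.log 6) := by
        rw [Real.exp_nat_mul, Real.exp_log (by norm_num)]
        norm_num
      rw [h6, ← Real.exp_nat_mul, ← Real.exp_add, ← Real.exp_add, ← Real.exp_add]
      refine Real.exp_le_exp.2 ?_
      have h1 := mul_le_mul_of_nonneg_right (hm2 n hn) hb0.le
      have h2 := mul_le_mul_of_nonneg_left hrb (n.cast_nonneg (α := ℝ))
      simp only [hb] at h1 h2 ⊢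
      linarith
  have hsum : ∑' n, ν (S n) ≠ ⊤ := by
    have hgeo : Summable fun n : ℕ => Real.exp (3 * b) * Real.exp (-η) ^ n :=
      (summable_geometric_of_lt_one (Real.exp_pos _).le
        (by rw [Real.exp_lt_one_iff]; linarith)).mul_left _
    refine ne_top_of_le_ne_top ?_ (ENNReal.tsum_le_tsum hSle)
    rw [← ENNReal.ofReal_tsum_of_nonneg (fun n => by positivity) hgeo]
    exact ENNReal.ofReal_ne_top
  filter_upwards [hcyl, ae_eventually_notMem hsum] with x hx1 hx2
  have hev : ∀ᶠ n : ℕ in atTop, ENNReal.ofReal (a / s₀) ≤ localRate μ φ x ε (n * s₀) := by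
    filter_upwards [hmtop.eventually hx1, hx2, eventually_ge_atTop 2] with n h1 h2 h3
    have hn : (0 : ℝ) < n := by exact_mod_cast (by omega : 0 < n)
    refine le_localRate (by positivity) ?_
    by_contra! hcon
    have e : (n : ℝ) * s₀ * (a / s₀) = n * a := by field_simp
    rw [e] at hcon
    exact h2 ⟨h3, hcon, h1⟩
  have hlim := le_liminf_of_le (by isBoundedDefault) hev
  calc labelEntropy ν (φ s₀) Q
      = ENNReal.ofReal (Real.log 6 + 2 * η) + ENNReal.ofReal s₀ * ENNReal.ofReal (a / s₀) := by
        rw [← ENNReal.ofReal_mul hs₀.le, ← ENNReal.ofReal_add (by positivity) (by positivity),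
          hHeq, mul_div_cancel₀ _ hs₀.ne']
        congr 1
        simp only [ha]; ring
    _ ≤ _ := by gcongr

end LocalBound

section Labels

open TopologicalSpace

variable [MetricSpace X] [MeasurableSpace X] [BorelSpace X]

/-- The labelling associated with separated open sets; the label `0` is given outside. -/
lemma exists_label {k : ℕ} (U : Fin k → Set X) (hU : ∀ i, IsOpen (U i)) {e : ℝ} (he : 0 < e)
    (hsep : ∀ i j, i ≠ j → ∀ x ∈ U i, ∀ y ∈ U j, e ≤ dist x y) :
    ∃ Q : X → Fin (k + 1), Measurable Q ∧ (∀ x i, Q x = i.succ ↔ x ∈ U i) ∧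
      ∀ x y, Q x ≠ 0 → Q y ≠ 0 → Q x ≠ Q y → e ≤ dist x y := by
  classical
  let Q : X → Fin (k + 1) := fun x => if h : ∃ i, x ∈ U i then h.choose.succ else 0
  have hQ : ∀ x i, Q x = i.succ ↔ x ∈ U i := by
    intro x i
    by_cases h : ∃ i, x ∈ U i
    · simp only [Q, dif_pos h, Fin.succ_inj]
      refine ⟨fun hi => hi ▸ h.choose_spec, fun hi => ?_⟩
      by_contra hne
      have := hsep _ _ hne x h.choose_spec x hi
      rw [dist_self] at this
      linarith
    · simp only [Q, dif_neg h]
      exact ⟨fun h0 => absurd h0.symm (Fin.succ_ne_zero i), fun hi => absurd ⟨i, hi⟩ h⟩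
  refine ⟨Q, measurable_to_countable' fun j => ?_, hQ, fun x y hx hy hxy => ?_⟩
  · refine Fin.cases ?_ (fun i => ?_) j
    · have : Q ⁻¹' {0} = (⋃ i, U i)ᶜ := by
        ext x
        by_cases h : ∃ i, x ∈ U i
        · simp [Q, h]
        · simp [show Q x = 0 from dif_neg h, not_exists.1 h]
      rw [this]
      exact (isOpen_iUnion hU).measurableSet.compl
    · have : Q ⁻¹' {i.succ} = U i := by
        ext x
        exact hQ x i
      rw [this]
      exact (hU i).measurableSet
  · obtain ⟨i, hi⟩ := Fin.exists_succ_eq.2 hx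
    obtain ⟨j, hj⟩ := Fin.exists_succ_eq.2 hy
    refine hsep i j ?_ x ((hQ x i).1 hi.symm) y ((hQ y j).1 hj.symm)
    rintro rfl
    exact hxy (hi.symm.trans hj)

/-- A finite measurable partition is approximated by separated finite unions of basic open
sets. -/
lemma exists_separated_basis_approx [CompactSpace X] (ν : Measure X) [IsFiniteMeasure ν] {k : ℕ}
    {P : X → Fin k} (hP : Measurable P) {δ : ℝ≥0∞} (hδ : δ ≠ 0) :
    ∃ F : Fin k → Finset (countableBasis X), (∀ i, ν (P ⁻¹' {i} \ ⋃ B ∈ F i, (B : Set X)) ≤ δ) ∧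
      ∃ e : ℝ, 0 < e ∧ ∀ i j, i ≠ j → ∀ x ∈ ⋃ B ∈ F i, (B : Set X),
        ∀ y ∈ ⋃ B ∈ F j, (B : Set X), e ≤ dist x y := by
  classical
  have hK : ∀ i, ∃ K, K ⊆ P ⁻¹' {i} ∧ IsCompact K ∧ ν (P ⁻¹' {i} \ K) < δ := fun i =>
    (hP (measurableSet_singleton i)).exists_isCompact_sdiff_lt (measure_ne_top _ _) hδ
  choose K hKP hKc hKν using hK
  have hev : ∀ i j, i ≠ j → ∀ᶠ e : ℝ in 𝓝[>] 0, ∀ x ∈ K i, ∀ y ∈ K j, e ≤ dist x y := by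
    intro i j hij
    have hdisj : Disjoint (K i) (K j) := by
      refine Disjoint.mono (hKP i) (hKP j) (Disjoint.preimage _ ?_)
      simpa using hij
    obtain ⟨r, hr, h⟩ := Metric.exists_pos_forall_lt_edist (hKc i) (hKc j).isClosed hdisj
    filter_upwards [Ioo_mem_nhdsGT (show (0 : ℝ) < r from hr)] with e he x hx y hy
    have h1 := h x hx y hy
    rw [edist_nndist, ENNReal.coe_lt_coe] at h1
    exact he.2.le.trans (NNReal.coe_lt_coe.2 h1).le
  have hev' : ∀ᶠ e : ℝ in 𝓝[>] 0, ∀ i j, i ≠ j → ∀ x ∈ K i, ∀ y ∈ K j, e ≤ dist x y := by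
    simp only [eventually_all]
    exact hev
  obtain ⟨e, he, he0⟩ := (hev'.and self_mem_nhdsWithin).exists
  replace he0 : 0 < e := he0
  have hB : ∀ x : X, ∃ B : countableBasis X, x ∈ (B : Set X) ∧
      (B : Set X) ⊆ Metric.ball x (e / 3) := by
    intro x
    obtain ⟨B, hB, hxB, hBb⟩ := (isBasis_countableBasis X).exists_subset_of_mem_open
      (Metric.mem_ball_self (show 0 < e / 3 by positivity)) Metric.isOpen_ball
    exact ⟨⟨B, hB⟩, hxB, hBb⟩
  choose B hxB hBb using hB
  have hcov : ∀ i, ∃ t : Finset X, (∀ x ∈ t, x ∈ K i) ∧ K i ⊆ ⋃ x ∈ t, (B x : Set X) := fun i =>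
    (hKc i).elim_nhds_subcover (fun x => (B x : Set X)) fun x _ =>
      (isOpen_of_mem_countableBasis (B x).2).mem_nhds (hxB x)
  choose t htK htc using hcov
  have hU : ∀ i, (⋃ b ∈ (t i).image B, (b : Set X)) = ⋃ x ∈ t i, (B x : Set X) := fun i => by
    simp
  refine ⟨fun i => (t i).image B, fun i => ?_, e / 3, by positivity, ?_⟩
  · rw [hU]
    exact (measure_mono (Set.sdiff_subset_sdiff_right (htc i))).trans (hKν i).le
  · intro i j hij x hx y hy
    rw [hU] at hx hy
    simp only [Set.mem_iUnion] at hx hy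
    obtain ⟨x', hx', hx⟩ := hx
    obtain ⟨y', hy', hy⟩ := hy
    have h1 := he i j hij x' (htK i x' hx') y' (htK j y' hy')
    have h2 := hBb _ hx
    have h3 := hBb _ hy
    rw [Metric.mem_ball] at h2 h3
    rw [dist_comm] at h2 h3
    have := dist_triangle4 x' x y y'
    rw [dist_comm y y'] at this
    linarith

/-- A labelling with finitely many labels, the nonzero ones being metrically separated. -/
structure SeparatedLabel (X : Type*) [MetricSpace X] [MeasurableSpace X] where
  k : ℕ
  Q : X → Fin (k + 1)
  measurable : Measurable Q
  gap : ℝ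
  gap_pos : 0 < gap
  separated : ∀ x y, Q x ≠ 0 → Q y ≠ 0 → Q x ≠ Q y → gap ≤ dist x y

/-- The Kolmogorov–Sinai entropy is computed by countably many separated labellings. -/
lemma exists_seq_separatedLabel (X : Type*) [MetricSpace X] [CompactSpace X] [MeasurableSpace X]
    [BorelSpace X] :
    ∃ Λ : ℕ → SeparatedLabel X, ∀ (ν : Measure X) [IsProbabilityMeasure ν] (T : X → X),
      MeasurePreserving T ν ν → kolSinai ν T = ⨆ j, labelEntropy ν T (Λ j).Q := by
  classical
  let U : (c : Σ k : ℕ, (Fin k → Finset (countableBasis X))) → Fin c.1 → Set X :=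
    fun c i => ⋃ B ∈ c.2 i, (B : Set X)
  let Sep : (Σ k : ℕ, (Fin k → Finset (countableBasis X))) → Prop := fun c =>
    ∃ e : ℝ, 0 < e ∧ ∀ i j, i ≠ j → ∀ x ∈ U c i, ∀ y ∈ U c j, e ≤ dist x y
  have hUo : ∀ c i, IsOpen (U c i) := fun c i =>
    isOpen_iUnion fun B => isOpen_iUnion fun _ => isOpen_of_mem_countableBasis B.2
  have hlabel : ∀ c : {c // Sep c}, ∃ l : SeparatedLabel X, ∃ h : l.k = c.1.1,
      ∀ x (i : Fin c.1.1), l.Q x = Fin.cast (by rw [h]) i.succ ↔ x ∈ U c.1 i := by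
    rintro ⟨c, e, he, hsep⟩
    obtain ⟨Q, h1, h2, h3⟩ := exists_label (U c) (hUo c) he hsep
    exact ⟨⟨c.1, Q, h1, e, he, h3⟩, rfl, h2⟩
  choose l hlk hl using hlabel
  have : Nonempty {c // Sep c} := ⟨⟨⟨0, fun i => i.elim0⟩, 1, one_pos, fun i => i.elim0⟩⟩
  obtain ⟨σ, hσ⟩ := exists_surjective_nat {c // Sep c}
  refine ⟨fun j => l (σ j), fun ν _ T hT => le_antisymm ?_ ?_⟩
  · rw [kolSinai_eq]
    refine iSup_le fun k => iSup_le fun P => iSup_le fun hP => ?_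
    refine ENNReal.le_of_forall_pos_le_add fun ε hε _ => ?_
    have hX : Nonempty X := nonempty_of_isProbabilityMeasure ν
    have hk : 0 < k := hX.elim fun x => (P x).pos
    have hε' : (0 : ℝ) < ε := hε
    set θ := 1 - Real.exp (-(ε / 2 : ℝ)) with hθ
    have hθ0 : 0 < θ := by
      have : Real.exp (-(ε / 2 : ℝ)) < 1 := by rw [Real.exp_lt_one_iff]; linarith
      linarith
    have hθ1 : θ < 1 := by linarith [Real.exp_pos (-(ε / 2 : ℝ))]
    set A := |Real.log (k / θ)| + 1 with hA
    have hA0 : 0 < A := by positivity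
    have hk' : (0 : ℝ) < k := by exact_mod_cast hk
    set δ := (ε : ℝ) / (2 * (k * A)) with hδ
    have hδ0 : 0 < δ := by positivity
    obtain ⟨F, hF, hsep⟩ := exists_separated_basis_approx ν hP
      (δ := ENNReal.ofReal δ) (by simpa using hδ0)
    obtain ⟨j, hj⟩ := hσ ⟨⟨k, F⟩, hsep⟩
    set Δ := ⋃ i, P ⁻¹' {i} \ U ⟨k, F⟩ i with hΔ
    have hΔm : MeasurableSet Δ := MeasurableSet.iUnion fun i =>
      (hP (measurableSet_singleton i)).diff (hUo ⟨k, F⟩ i).measurableSet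
    have hΔν : ν.real Δ ≤ k * δ := by
      refine ENNReal.toReal_le_of_le_ofReal (by positivity) ?_
      calc ν Δ ≤ ∑ i, ν (P ⁻¹' {i} \ U ⟨k, F⟩ i) := measure_iUnion_fintype_le _ _
        _ ≤ ∑ _i : Fin k, ENNReal.ofReal δ := Finset.sum_le_sum fun i _ => hF i
        _ = ENNReal.ofReal (k * δ) := by
          rw [ENNReal.ofReal_mul hk'.le, ENNReal.ofReal_natCast]; simp
    have hmain : labelEntropy ν T P ≤ labelEntropy ν T (l (σ j)).Q +
        ENNReal.ofReal (-Real.log (1 - θ) + ν.real Δ * Real.log (k / θ)) := by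
      rw [hj]
      have hk0 := hlk ⟨⟨k, F⟩, hsep⟩
      refine labelEntropy_le_of_guess ν hT hP (l ⟨⟨k, F⟩, hsep⟩).measurable
        (fun q => if h : ∃ i : Fin k, q = Fin.cast (by rw [hk0]) i.succ then h.choose else
          ⟨0, hk⟩) hΔm (fun x hx => ?_) hθ0 hθ1
      have hxU : x ∈ U ⟨k, F⟩ (P x) := by
        by_contra hxU
        exact hx (Set.mem_iUnion.2 ⟨P x, rfl, hxU⟩)
      have hq := (hl ⟨⟨k, F⟩, hsep⟩ x (P x)).2 hxU
      have hex : ∃ i : Fin k, (l ⟨⟨k, F⟩, hsep⟩).Q x = Fin.cast (by rw [hk0]) i.succ := ⟨P x, hq⟩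
      rw [dif_pos hex]
      have := hex.choose_spec.symm.trans hq
      simpa using this
    refine hmain.trans (add_le_add (le_iSup (fun j => labelEntropy ν T (l (σ j)).Q) j) ?_)
    rw [← ENNReal.ofReal_coe_nnreal]
    refine ENNReal.ofReal_le_ofReal ?_
    have h1 : -Real.log (1 - θ) = ε / 2 := by simp [hθ]
    have h2 : ν.real Δ * Real.log (k / θ) ≤ k * δ * A :=
      (mul_le_mul_of_nonneg_left ((le_abs_self _).trans (by linarith)) measureReal_nonneg).trans
        (mul_le_mul_of_nonneg_right hΔν hA0.le)
    have h3 : k * δ * A = ε / 2 := by rw [hδ]; field_simp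
    linarith
  · rw [kolSinai_eq]
    refine iSup_le fun j => ?_
    exact le_iSup_of_le _ (le_iSup_of_le _ (le_iSup_of_le (l (σ j)).measurable le_rfl))

end Labels

section Disintegration

variable [MeasurableSpace X] {Y : Type*} [MeasurableSpace Y] {μ : Measure X} {π : Measure Y}
  {μy : Y → Measure X} {ρ : X → Y}

lemma aemeasurable_component [IsProbabilityMeasure μ] [IsProbabilityMeasure π]
    (hprob : ∀ y, IsProbabilityMeasure (μy y))
    (hdis : ∀ s : Set X, MeasurableSet s → μ s = ∫⁻ y, μy y s ∂π) {s : Set X}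
    (hs : MeasurableSet s) : AEMeasurable (fun y => μy y s) π := by
  obtain ⟨g, hg, hgf, hgi⟩ := exists_measurable_le_lintegral_eq π fun y => μy y s
  obtain ⟨g', hg', hgf', hgi'⟩ := exists_measurable_le_lintegral_eq π fun y => μy y sᶜ
  have hle : ∀ y, g y + g' y ≤ 1 := fun y =>
    (add_le_add (hgf y) (hgf' y)).trans_eq (prob_add_prob_compl hs)
  have hsum_int : ∫⁻ y, (g y + g' y) ∂π = 1 := by
    rw [lintegral_add_left hg, ← hgi, ← hgi', ← hdis s hs, ← hdis sᶜ hs.compl,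
      prob_add_prob_compl hs]
  have hae : (fun y => g y + g' y) =ᵐ[π] fun _ => 1 :=
    ae_eq_of_ae_le_of_lintegral_le (Eventually.of_forall hle) (by simp [hsum_int])
      aemeasurable_const (by simp [hsum_int])
  refine ⟨g, hg, ?_⟩
  filter_upwards [hae] with y hy
  refine le_antisymm ?_ (hgf y)
  have h1 : μy y s + g' y ≤ g y + g' y := by
    rw [hy, ← prob_add_prob_compl (μ := μy y) hs]
    exact add_le_add le_rfl (hgf' y)
  refine ENNReal.le_of_add_le_add_right ?_ h1
  exact ne_top_of_le_ne_top ENNReal.one_ne_top (le_add_self.trans (hle y))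

lemma aemeasurable_labelEntropy [IsProbabilityMeasure μ] [IsProbabilityMeasure π]
    (hprob : ∀ y, IsProbabilityMeasure (μy y))
    (hdis : ∀ s : Set X, MeasurableSet s → μ s = ∫⁻ y, μy y s ∂π) {T : X → X}
    (hT : Measurable T) {k : ℕ} {Q : X → Fin k} (hQ : Measurable Q) :
    AEMeasurable (fun y => labelEntropy (μy y) T Q) π := by
  have h1 : ∀ n : ℕ, AEMeasurable (fun y =>
      ENNReal.ofReal (partEnt (μy y) (itinerary T Q n) / n)) π := by
    intro n
    refine (AEMeasurable.div_const ?_ _).ennreal_ofReal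
    refine Finset.aemeasurable_fun_sum _ fun w _ => ?_
    exact Real.continuous_negMulLog.measurable.comp_aemeasurable
      (aemeasurable_component hprob hdis
        (measurable_itinerary hT hQ n (measurableSet_singleton w))).ennreal_toReal
  refine ⟨fun y => limsup (fun n => (h1 n).mk _ y) atTop,
    Measurable.limsup fun n => (h1 n).measurable_mk, ?_⟩
  filter_upwards [ae_all_iff.2 fun n => (h1 n).ae_eq_mk] with y hy
  simp only [labelEntropy]
  exact congrArg (fun u => limsup u atTop) (funext hy)

variable [MeasurableSingletonClass Y]

/-- The quotient measure of a disintegration over fibers is the image measure. -/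
lemma map_eq_of_fiber (hρ : Measurable ρ) (hprob : ∀ y, IsProbabilityMeasure (μy y))
    (hfiber : ∀ y, μy y (ρ ⁻¹' {y}) = 1)
    (hdis : ∀ s : Set X, MeasurableSet s → μ s = ∫⁻ y, μy y s ∂π) : μ.map ρ = π := by
  ext B hB
  rw [Measure.map_apply hρ hB, hdis _ (hρ hB), ← lintegral_indicator_one hB]
  refine lintegral_congr fun y => ?_
  by_cases hy : y ∈ B
  · rw [Set.indicator_of_mem hy, Pi.one_apply]
    refine le_antisymm prob_le_one ?_
    rw [← hfiber y]
    exact measure_mono (Set.preimage_mono (Set.singleton_subset_iff.2 hy))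
  · rw [Set.indicator_of_notMem hy]
    refine measure_mono_null (t := (ρ ⁻¹' {y})ᶜ) ?_
      ((prob_compl_eq_zero_iff (hρ (measurableSet_singleton y))).2 (hfiber y))
    rintro x hx rfl
    exact hy hx

/-- A lower bound holding almost everywhere on each component integrates. -/
lemma setLIntegral_le_of_ae_component (hρ : Measurable ρ)
    (hprob : ∀ y, IsProbabilityMeasure (μy y)) (hfiber : ∀ y, μy y (ρ ⁻¹' {y}) = 1)
    (hdis : ∀ s : Set X, MeasurableSet s → μ s = ∫⁻ y, μy y s ∂π) {D : Set Y}
    (hD : MeasurableSet D) {G : Y → ℝ≥0∞} (hG : Measurable G) {F : X → ℝ≥0∞}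
    (hF : Measurable F) (hGF : ∀ y ∈ D, ∀ᵐ x ∂μy y, G y ≤ F x) :
    ∫⁻ y in D, G y ∂π ≤ ∫⁻ x in ρ ⁻¹' D, F x ∂μ := by
  rw [← map_eq_of_fiber hρ hprob hfiber hdis, setLIntegral_map hD hG hρ]
  refine setLIntegral_mono_ae hF.aemeasurable ?_
  have hZm : MeasurableSet {x | ρ x ∈ D ∧ F x < G (ρ x)} :=
    (hρ hD).inter (measurableSet_lt hF (hG.comp hρ))
  have hZ : μ {x | ρ x ∈ D ∧ F x < G (ρ x)} = 0 := by
    rw [hdis _ hZm, ← lintegral_zero (μ := π)]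
    refine lintegral_congr fun y => ?_
    have hy : ∀ᵐ x ∂μy y, ρ x = y :=
      (prob_compl_eq_zero_iff (hρ (measurableSet_singleton y))).2 (hfiber y)
    by_cases hyD : y ∈ D
    · have : ∀ᵐ x ∂μy y, ¬ (ρ x ∈ D ∧ F x < G (ρ x)) := by
        filter_upwards [hy, hGF y hyD] with x hx h1 h2
        rw [hx] at h2
        exact absurd h2.2 (not_lt.2 h1)
      simpa [ae_iff] using this
    · have : ∀ᵐ x ∂μy y, ¬ (ρ x ∈ D ∧ F x < G (ρ x)) := by
        filter_upwards [hy] with x hx h2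
        rw [hx] at h2
        exact hyD h2.1
      simpa [ae_iff] using this
  have : ∀ᵐ x ∂μ, ¬ (ρ x ∈ D ∧ F x < G (ρ x)) := by simpa [ae_iff] using hZ
  filter_upwards [this] with x hx hxD
  exact not_lt.1 fun h => hx ⟨hxD, h⟩

end Disintegration

/-- A bounded increasing approximation `g j ↑ h` can be replaced, on a set of almost full
measure, by finitely many terms, so that a gain on this set makes up for the loss outside. -/
lemma exists_exceptional_set {Y : Type*} [MeasurableSpace Y] (π : Measure Y) [IsFiniteMeasure π]
    {S : Set Y} (hS : MeasurableSet S) {g : ℕ → Y → ℝ≥0∞} (hg : ∀ j, Measurable (g j))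
    {M c : ℝ≥0∞} (hM : M ≠ ⊤) (hc : c ≠ 0) (hc' : c ≠ ⊤) (hgM : ∀ y ∈ S, ⨆ j, g j y < M) :
    ∃ (J : ℕ) (D : Set Y), MeasurableSet D ∧ D ⊆ S ∧
      (∀ y ∈ D, ∃ j ≤ J, ⨆ i, g i y < g j y + c) ∧
      ∫⁻ y in S, ⨆ j, g j y ∂π ≤ ∫⁻ y in D, ((⨆ j, g j y) + c) ∂π := by
  set h : Y → ℝ≥0∞ := fun y => ⨆ j, g j y with hh
  have hhm : Measurable h := Measurable.iSup hg
  let E : ℕ → Set Y := fun J => S ∩ ⋂ j ≤ J, {y | g j y + c ≤ h y}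
  have hEm : ∀ J, MeasurableSet (E J) := fun J =>
    hS.inter (MeasurableSet.biInter (Set.to_countable _) fun j _ =>
      measurableSet_le ((hg j).add_const c) hhm)
  have hanti : Antitone E := fun J J' hJ =>
    Set.inter_subset_inter_right _ (Set.biInter_subset_biInter_left fun j hj => le_trans hj hJ)
  have hempty : ⋂ J, E J = ∅ := by
    ext y
    simp only [Set.mem_iInter, Set.mem_empty_iff_false, iff_false]
    intro hy
    have hyS : y ∈ S := (hy 0).1
    have hlt : h y < (⨆ j, g j y) + c :=
      ENNReal.lt_add_right (ne_top_of_lt (hgM y hyS)) hc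
    rw [ENNReal.iSup_add, lt_iSup_iff] at hlt
    obtain ⟨j, hj⟩ := hlt
    have := (Set.mem_iInter₂.1 (hy j).2) j le_rfl
    exact absurd this (not_le.2 hj)
  have htend : Tendsto (fun J => π (E J)) atTop (𝓝 0) := by
    have := tendsto_measure_iInter_atTop (μ := π) (fun J => (hEm J).nullMeasurableSet) hanti
      ⟨0, measure_ne_top _ _⟩
    rwa [hempty, measure_empty] at this
  obtain ⟨J, hJ⟩ : ∃ J, (M + c) * π (E J) ≤ c * π S := by
    rcases eq_or_ne (π S) 0 with h0 | h0
    · exact ⟨0, by rw [measure_mono_null Set.inter_subset_left h0]; simp⟩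
    · have h1 : Tendsto (fun J => (M + c) * π (E J)) atTop (𝓝 ((M + c) * 0)) :=
        ENNReal.Tendsto.const_mul htend (Or.inr (ENNReal.add_ne_top.2 ⟨hM, hc'⟩))
      rw [mul_zero] at h1
      exact ((h1.eventually_lt_const (ENNReal.mul_pos hc h0)).exists).imp fun _ => le_of_lt
  refine ⟨J, S \ E J, hS.diff (hEm J), Set.sdiff_subset, ?_, ?_⟩
  · rintro y ⟨hyS, hyE⟩
    by_contra! hcon
    exact hyE ⟨hyS, Set.mem_iInter₂.2 fun j hj => hcon j hj⟩
  · have hES : E J ⊆ S := Set.inter_subset_left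
    refine ENNReal.le_of_add_le_add_right
      (ENNReal.mul_ne_top hc' (measure_ne_top π (E J))) ?_
    calc ∫⁻ y in S, h y ∂π + c * π (E J)
        = ∫⁻ y in S \ E J, h y ∂π + ∫⁻ y in E J, h y ∂π + c * π (E J) := by
          rw [← lintegral_inter_add_sdiff h S (hEm J), Set.inter_eq_self_of_subset_right hES,
            add_comm (∫⁻ y in E J, h y ∂π)]
      _ ≤ ∫⁻ y in S \ E J, h y ∂π + M * π (E J) + c * π (E J) := by
          gcongr
          rw [← setLIntegral_const]
          exact setLIntegral_mono measurable_const fun y hy => (hgM y (hES hy)).le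
      _ = ∫⁻ y in S \ E J, h y ∂π + (M + c) * π (E J) := by ring
      _ ≤ ∫⁻ y in S \ E J, h y ∂π + c * π S := by gcongr
      _ = ∫⁻ y in S \ E J, (h y + c) ∂π + c * π (E J) := by
          rw [lintegral_add_right _ measurable_const, setLIntegral_const, add_assoc, ← mul_add,
            ← measure_sdiff_add_inter S (hEm J), Set.inter_eq_self_of_subset_right hES]

/-- **Claim 1 (1).** Let `μ = ∫_Y μ_y dπ(y)` be the ergodic decomposition of `μ` with
respect to `φ_{Lτ}`, with `h(y) = h_{μ_y}(φ_{Lτ})`, `L ≥ (2 log 6 + p)/(pτ)`, and let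
`X_M` be the union of ergodic components with `h(y) < M`. Then for all sufficiently small
`ε > 0`,
`∫_{X_M} [p + liminf_n −(1/(nLτ)) log μ(B(x,nLτ,ε,φ))] dμ ≥ (1/(Lτ)) ∫_{h⁻¹([0,M))} h dπ`. -/
theorem lintegral_rate_lower_bound {X : Type*} [MetricSpace X]
    [CompactSpace X] [MeasurableSpace X] [BorelSpace X]
    {Y : Type*} [MeasurableSpace Y] [MeasurableSingletonClass Y]
    (φ : ℝ → X → X) (hφ : IsFlow φ) (hfp : FixedPointFree φ)
    (μ : Measure X) [IsProbabilityMeasure μ] (hinv : FlowInvariant φ μ)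
    (τ : ℝ) (hτ : 0 < τ) (p : ℝ) (hp : 0 < p)
    (L : ℕ) (hL : 0 < L) (hLbig : (2 * Real.log 6 + p) / (p * τ) ≤ (L : ℝ))
    (M : ℝ) (hM : 0 < M)
    (π : Measure Y) [IsProbabilityMeasure π]
    (μy : Y → Measure X) (ρ : X → Y) (hρ : Measurable ρ)
    (hprob : ∀ y, IsProbabilityMeasure (μy y))
    (herg : ∀ y, Ergodic (φ ((L : ℝ) * τ)) (μy y))
    (hfiber : ∀ y, μy y (ρ ⁻¹' {y}) = 1)
    (hdis : ∀ s : Set X, MeasurableSet s → μ s = ∫⁻ y, μy y s ∂π) :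
    ∃ ε₀ : ℝ, 0 < ε₀ ∧ ∀ ε : ℝ, 0 < ε → ε < ε₀ →
      (ENNReal.ofReal ((L : ℝ) * τ))⁻¹ *
          ∫⁻ y in {y | kolSinai (μy y) (φ ((L : ℝ) * τ)) < ENNReal.ofReal M},
            kolSinai (μy y) (φ ((L : ℝ) * τ)) ∂π ≤
        ∫⁻ x in ρ ⁻¹' {y | kolSinai (μy y) (φ ((L : ℝ) * τ)) < ENNReal.ofReal M},
          (ENNReal.ofReal p +
            Filter.liminf (fun n : ℕ => localRate μ φ x ε ((n : ℝ) * ((L : ℝ) * τ)))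
              Filter.atTop) ∂μ := by
  set s₀ : ℝ := (L : ℝ) * τ with hs
  have hL' : (0 : ℝ) < L := by exact_mod_cast hL
  have hs₀ : 0 < s₀ := mul_pos hL' hτ
  have hsp : 2 * Real.log 6 + p ≤ s₀ * p := by
    rw [div_le_iff₀ (mul_pos hp hτ)] at hLbig
    calc _ ≤ _ := hLbig
      _ = s₀ * p := by rw [hs]; ring
  have hlog6 : 5 / 4 ≤ Real.log 6 := by
    have h1 := Real.log_two_gt_d9
    have h2 : 2 * Real.log 2 ≤ Real.log 6 := by
      rw [← Real.log_rpow two_pos]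
      exact Real.log_le_log (by norm_num) (by norm_num)
    linarith
  have hTm : Measurable (φ s₀) := (hφ.continuous_time s₀).measurable
  obtain ⟨Λ, hΛ⟩ := exists_seq_separatedLabel X
  have hkol : ∀ y, kolSinai (μy y) (φ s₀) = ⨆ j, labelEntropy (μy y) (φ s₀) (Λ j).Q := fun y =>
    hΛ (μy y) (φ s₀) (herg y).toMeasurePreserving
  have hlab : ∀ j, AEMeasurable (fun y => labelEntropy (μy y) (φ s₀) (Λ j).Q) π := fun j =>
    aemeasurable_labelEntropy hprob hdis hTm (Λ j).measurable
  set g : ℕ → Y → ℝ≥0∞ := fun j => (hlab j).mk _ with hg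
  have hgm : ∀ j, Measurable (g j) := fun j => (hlab j).measurable_mk
  have hae : ∀ᵐ y ∂π, ∀ j, labelEntropy (μy y) (φ s₀) (Λ j).Q = g j y :=
    ae_all_iff.2 fun j => (hlab j).ae_eq_mk
  obtain ⟨N, hNsub, hNm, hN⟩ := exists_measurable_superset_of_null (ae_iff.1 hae)
  have hgN : ∀ y ∉ N, ∀ j, labelEntropy (μy y) (φ s₀) (Λ j).Q = g j y := fun y hy => by
    by_contra h
    exact hy (hNsub h)
  have hkolN : ∀ y ∉ N, kolSinai (μy y) (φ s₀) = ⨆ j, g j y := fun y hy => by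
    rw [hkol]
    exact iSup_congr (hgN y hy)
  set S := {y | kolSinai (μy y) (φ s₀) < ENNReal.ofReal M} with hS
  set S' := {y | ⨆ j, g j y < ENNReal.ofReal M} \ N with hS'
  have hS'm : MeasurableSet S' :=
    (measurableSet_lt (Measurable.iSup hgm) measurable_const).diff hNm
  have hsub : S' ⊆ S := by
    rintro y ⟨hy, hyN⟩
    change kolSinai (μy y) (φ s₀) < ENNReal.ofReal M
    rw [hkolN y hyN]
    exact hy
  have hNae : ∀ᵐ y ∂π, y ∉ N := measure_eq_zero_iff_ae_notMem.1 hN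
  have hSae : S =ᵐ[π] S' := by
    filter_upwards [hNae] with y hy
    refine propext ⟨fun h => ⟨?_, hy⟩, fun h => hsub h⟩
    change ⨆ j, g j y < ENNReal.ofReal M
    rw [← hkolN y hy]
    exact h
  set c : ℝ≥0∞ := ENNReal.ofReal (1 / 2) with hc
  obtain ⟨J, D, hDm, hDS, hDj, hDint⟩ := exists_exceptional_set π hS'm hgm
    (M := ENNReal.ofReal M) (c := c) ENNReal.ofReal_ne_top (by simp [hc])
    ENNReal.ofReal_ne_top fun y hy => hy.1
  choose ε' hε'0 hε' using fun j => ae_labelEntropy_le_liminf_localRate hφ hfp hs₀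
    (Λ j).measurable (Λ j).gap_pos (Λ j).separated (show (0 : ℝ) < 1 / 8 by norm_num)
  have hne : (Finset.range (J + 1)).Nonempty := ⟨0, by simp⟩
  refine ⟨(Finset.range (J + 1)).inf' hne ε', (Finset.lt_inf'_iff hne).2 fun j _ => hε'0 j,
    fun ε _ hε => ?_⟩
  set F : X → ℝ≥0∞ := fun x => ENNReal.ofReal p +
    Filter.liminf (fun n : ℕ => localRate μ φ x ε ((n : ℝ) * s₀)) Filter.atTop with hF
  have hFm : Measurable F :=
    (Measurable.liminf fun n => measurable_localRate hφ μ (n * s₀) ε).const_add _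
  have hs₀' : ENNReal.ofReal s₀ ≠ 0 := by simpa using hs₀
  have hpt : ∀ y ∈ D, ∀ᵐ x ∂μy y, (⨆ j, g j y) + c ≤ ENNReal.ofReal s₀ * F x := by
    intro y hy
    obtain ⟨j, hjJ, hj⟩ := hDj y hy
    have hεj : ε < ε' j :=
      hε.trans_le (Finset.inf'_le ε' (Finset.mem_range.2 (Nat.lt_succ_of_le hjJ)))
    have hp' := hprob y
    filter_upwards [hε' j ε hεj μ (μy y) (herg y)] with x hx
    rw [hgN y (hDS hy).2] at hx
    set l := Filter.liminf (fun n : ℕ => localRate μ φ x ε ((n : ℝ) * s₀)) Filter.atTop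
    calc (⨆ j, g j y) + c ≤ g j y + c + c := by gcongr
      _ ≤ ENNReal.ofReal (Real.log 6 + 2 * (1 / 8)) + ENNReal.ofReal s₀ * l + c + c := by gcongr
      _ = ENNReal.ofReal (Real.log 6 + 2 * (1 / 8) + 1 / 2 + 1 / 2) + ENNReal.ofReal s₀ * l := by
        rw [ENNReal.ofReal_add (p := Real.log 6 + 2 * (1 / 8) + 1 / 2) (q := 1 / 2)
            (by linarith) (by norm_num),
          ENNReal.ofReal_add (p := Real.log 6 + 2 * (1 / 8)) (q := 1 / 2)
            (by linarith) (by norm_num), ← hc]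
        ring
      _ ≤ ENNReal.ofReal (s₀ * p) + ENNReal.ofReal s₀ * l := by
        gcongr
        linarith
      _ = ENNReal.ofReal s₀ * F x := by
        rw [ENNReal.ofReal_mul hs₀.le, hF, mul_add]
  calc (ENNReal.ofReal s₀)⁻¹ * ∫⁻ y in S, kolSinai (μy y) (φ s₀) ∂π
      = (ENNReal.ofReal s₀)⁻¹ * ∫⁻ y in S', ⨆ j, g j y ∂π := by
        rw [setLIntegral_congr hSae, setLIntegral_congr_fun hS'm fun y hy => hkolN y hy.2]
    _ ≤ (ENNReal.ofReal s₀)⁻¹ * ∫⁻ x in ρ ⁻¹' D, ENNReal.ofReal s₀ * F x ∂μ := by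
        gcongr
        exact hDint.trans (setLIntegral_le_of_ae_component hρ hprob hfiber hdis hDm
          ((Measurable.iSup hgm).add_const c) (hFm.const_mul _) hpt)
    _ = ∫⁻ x in ρ ⁻¹' D, F x ∂μ := by
        rw [lintegral_const_mul _ hFm, ← mul_assoc,
          ENNReal.inv_mul_cancel hs₀' ENNReal.ofReal_ne_top, one_mul]
    _ ≤ ∫⁻ x in ρ ⁻¹' S, F x ∂μ :=
        lintegral_mono_set (Set.preimage_mono (hDS.trans hsub))

end FlowEntropy
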